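/- arXiv:0812.2017 — 3 statements merged into one kernel-verified Lean document; each statement's English description precedes it below -/
import Mathlib

section
/- Let G be a countable amenable group, d ∈ ℕ, and E ⊆ Gᵈ. For g = (g₁, …, g_d), h = (h₁, …, h_d) ∈ Gᵈ, let h.g denote the set {(h₁^{-ε₁} g₁, …, h_d^{-ε_d} g_d) : ε ∈ {0,1}ᵈ}. If Ψ is a left Følner sequence in the group Gᵈ with d_Ψ(E) > 0, then for every c > 0 the set {h ∈ Gᵈ : d_Ψ({g ∈ Gᵈ : h.g ⊆ E}) > d_Ψ(E)^{2^d} − c} is both left syndetic and right syndetic in Gᵈ. -/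
open MeasureTheory Filter Topology

/-- A left Følner sequence: finite nonempty sets with `|Φ N ∩ gΦ N|/|Φ N| → 1` for all `g`. -/
def IsLeftFolner {G : Type*} [Group G] [DecidableEq G] (Φ : ℕ → Finset G) : Prop :=
  (∀ N, (Φ N).Nonempty) ∧
    ∀ g : G, Tendsto
      (fun N => (((Φ N) ∩ (Φ N).image (fun x => g * x)).card : ℝ) / ((Φ N).card : ℝ))
      atTop (𝓝 1)

/-- A right Følner sequence: finite nonempty sets with `|Φ N ∩ Φ N g|/|Φ N| → 1` for all `g`. -/
def IsRightFolner {G : Type*} [Group G] [DecidableEq G] (Φ : ℕ → Finset G) : Prop :=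
  (∀ N, (Φ N).Nonempty) ∧
    ∀ g : G, Tendsto
      (fun N => (((Φ N) ∩ (Φ N).image (fun x => x * g)).card : ℝ) / ((Φ N).card : ℝ))
      atTop (𝓝 1)

/-- A two-sided Følner sequence is both a left and a right Følner sequence. -/
def IsTwoSidedFolner {G : Type*} [Group G] [DecidableEq G] (Φ : ℕ → Finset G) : Prop :=
  IsLeftFolner Φ ∧ IsRightFolner Φ
/-- `S` is left syndetic: finitely many left translates of `S` cover the group. -/
def LeftSyndetic {H : Type*} [Group H] (S : Set H) : Prop :=
  ∃ F : Finset H, ∀ x : H, ∃ g ∈ F, g⁻¹ * x ∈ S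

/-- `S` is right syndetic: finitely many right translates of `S` cover the group. -/
def RightSyndetic {H : Type*} [Group H] (S : Set H) : Prop :=
  ∃ F : Finset H, ∀ x : H, ∃ g ∈ F, x * g⁻¹ ∈ S
open scoped Classical in
/-- Upper density of `A` with respect to the Følner sequence `Ψ`. -/
noncomputable def upperDensity {H : Type*} (Ψ : ℕ → Finset H) (A : Set H) : ℝ :=
  Filter.limsup
    (fun N => (((Ψ N).filter (fun x => x ∈ A)).card : ℝ) / ((Ψ N).card : ℝ)) Filter.atTop

namespace CubicConfigurations

open scoped BigOperators

/-- A mean on `X`: a linear functional, normalized and positive on bounded functions. Defining it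
on all functions keeps it totally linear; its values at unbounded functions play no role. -/
structure IsMean {X : Type*} (m : (X → ℝ) →ₗ[ℝ] ℝ) : Prop where
  nonneg : ∀ (f : X → ℝ) (C : ℝ), (∀ x, 0 ≤ f x) → (∀ x, f x ≤ C) → 0 ≤ m f
  one : m (fun _ => 1) = 1

namespace IsMean

variable {X : Type*} {m : (X → ℝ) →ₗ[ℝ] ℝ}

theorem const (hm : IsMean m) (c : ℝ) : m (fun _ => c) = c := by
  have h : (fun _ : X => c) = c • (fun _ : X => (1 : ℝ)) := by ext; simp
  rw [h, map_smul, hm.one, smul_eq_mul, mul_one]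

theorem mono (hm : IsMean m) {f g : X → ℝ} {C : ℝ} (hf : ∀ x, |f x| ≤ C) (hg : ∀ x, |g x| ≤ C)
    (hfg : ∀ x, f x ≤ g x) : m f ≤ m g := by
  have h := hm.nonneg (g - f) (C + C) (fun x => sub_nonneg.2 (hfg x)) (fun x => by
    have h1 := abs_le.1 (hf x)
    have h2 := abs_le.1 (hg x)
    simp only [Pi.sub_apply]
    linarith)
  rw [map_sub] at h
  linarith

theorem abs_le (hm : IsMean m) {f : X → ℝ} {C : ℝ} (hf : ∀ x, |f x| ≤ C) : |m f| ≤ C := by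
  have hc (x : X) : |C| ≤ C := (abs_of_nonneg ((abs_nonneg _).trans (hf x))).le
  have hc' (x : X) : |-C| ≤ C := by rw [abs_neg]; exact hc x
  rw [_root_.abs_le]
  constructor
  · rw [← hm.const (-C)]
    exact hm.mono hc' hf fun x => (_root_.abs_le.1 (hf x)).1
  · conv_rhs => rw [← hm.const C]
    exact hm.mono hf hc fun x => (_root_.abs_le.1 (hf x)).2

theorem sq_mul_le (hm : IsMean m) {f g : X → ℝ} {C D : ℝ} (hf : ∀ x, |f x| ≤ C)
    (hg : ∀ x, |g x| ≤ D) :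
    m (fun x => f x * g x) ^ 2 ≤ m (fun x => f x ^ 2) * m (fun x => g x ^ 2) := by
  have key : ∀ t : ℝ, 0 ≤ m (fun x => g x ^ 2) * (t * t) + (2 * m (fun x => f x * g x)) * t
      + m (fun x => f x ^ 2) := by
    intro t
    have h : (fun x => (f x + t * g x) ^ 2) = (t * t) • (fun x => g x ^ 2)
        + ((2 * t) • (fun x => f x * g x) + fun x => f x ^ 2) := by
      ext x
      simp only [Pi.add_apply, Pi.smul_apply, smul_eq_mul]
      ring
    have h0 := hm.nonneg (fun x => (f x + t * g x) ^ 2) ((C + |t| * D) ^ 2)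
      (fun x => sq_nonneg _) (fun x => by
        refine sq_le_sq' ?_ ?_ <;>
        · have h1 : |f x + t * g x| ≤ C + |t| * D := (abs_add_le _ _).trans (by
            rw [abs_mul]
            exact add_le_add (hf x) (mul_le_mul_of_nonneg_left (hg x) (abs_nonneg _)))
          have h2 := _root_.abs_le.1 h1
          linarith)
    rw [h, map_add, map_add, map_smul, map_smul, smul_eq_mul, smul_eq_mul] at h0
    linarith
  have h := discrim_le_zero key
  rw [discrim] at h
  nlinarith

theorem sq_le (hm : IsMean m) {f : X → ℝ} {C : ℝ} (hf : ∀ x, |f x| ≤ C) :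
    m f ^ 2 ≤ m (fun x => f x ^ 2) := by
  have h := hm.sq_mul_le (f := f) (g := fun _ => 1) (D := 1) hf (by simp)
  simpa [hm.one] using h

end IsMean

theorem map_expect {X K : Type*} (m : (X → ℝ) →ₗ[ℝ] ℝ) (s : Finset K) (F : K → X → ℝ) :
    m (fun x => 𝔼 i ∈ s, F i x) = 𝔼 i ∈ s, m (F i) := by
  have h : (fun x => 𝔼 i ∈ s, F i x) = ((s.card : ℝ)⁻¹) • ∑ i ∈ s, F i := by
    ext x
    simp [Finset.expect_eq_sum_div_card, div_eq_inv_mul]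
  rw [h, map_smul, map_sum, Finset.expect_eq_sum_div_card, smul_eq_mul, div_eq_inv_mul]

theorem abs_expect_le {K : Type*} (s : Finset K) {F : K → ℝ} {C : ℝ} (hC : 0 ≤ C)
    (h : ∀ i ∈ s, |F i| ≤ C) : |𝔼 i ∈ s, F i| ≤ C := by
  rcases s.eq_empty_or_nonempty with rfl | hs
  · simpa
  · exact abs_le.2 ⟨Finset.le_expect hs fun i hi => (abs_le.1 (h i hi)).1,
      Finset.expect_le hs fun i hi => (abs_le.1 (h i hi)).2⟩

theorem expect_sq_le {K : Type*} (s : Finset K) (F : K → ℝ) :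
    (𝔼 i ∈ s, F i) ^ 2 ≤ 𝔼 i ∈ s, F i ^ 2 := by
  rcases s.eq_empty_or_nonempty with rfl | hs
  · simp
  · have hc : (0 : ℝ) < s.card := by exact_mod_cast hs.card_pos
    rw [Finset.expect_eq_sum_div_card, Finset.expect_eq_sum_div_card, div_pow,
      div_le_div_iff₀ (by positivity) hc]
    nlinarith [sq_sum_le_card_mul_sum_sq (s := s) (f := F)]

theorem expect_pow_two_pow_le {K : Type*} (s : Finset K) (k : ℕ) (F : K → ℝ) :
    (𝔼 i ∈ s, F i) ^ (2 ^ k) ≤ 𝔼 i ∈ s, F i ^ (2 ^ k) := by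
  induction k generalizing F with
  | zero => simp
  | succ k ih =>
    have h := ih (fun i => F i ^ 2)
    simp only [← pow_mul] at h
    rw [pow_succ', pow_mul]
    exact (pow_le_pow_left₀ (sq_nonneg _) (expect_sq_le s F) _).trans h

theorem abs_prod_le_one {K : Type*} (s : Finset K) {F : K → ℝ} (h : ∀ i ∈ s, |F i| ≤ 1) :
    |∏ i ∈ s, F i| ≤ 1 := by
  rw [Finset.abs_prod]
  exact Finset.prod_le_one (fun _ _ => abs_nonneg _) h

theorem abs_mul_le_one {a b : ℝ} (ha : |a| ≤ 1) (hb : |b| ≤ 1) : |a * b| ≤ 1 := by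
  rw [abs_mul]
  exact mul_le_one₀ ha (abs_nonneg _) hb

/-- Positive normalized functionals have limits along ultrafilters, which are means. -/
theorem exists_mean_tendsto {X : Type*} (L : ℕ → (X → ℝ) →ₗ[ℝ] ℝ) (hL : ∀ N, IsMean (L N))
    (U : Ultrafilter ℕ) : ∃ m : (X → ℝ) →ₗ[ℝ] ℝ, IsMean m ∧
      ∀ (f : X → ℝ) (C : ℝ), (∀ x, |f x| ≤ C) → Tendsto (fun N => L N f) U (𝓝 (m f)) := by
  have hlim : ∀ f : X → ℝ, (∃ C, ∀ x, |f x| ≤ C) →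
      ∃ a, Tendsto (fun N => L N f) U (𝓝 a) := by
    rintro f ⟨C, hC⟩
    have hmem : ∀ N, L N f ∈ Set.Icc (-C) C := fun N => abs_le.1 ((hL N).abs_le hC)
    obtain ⟨a, -, ha⟩ := (isCompact_Icc (a := -C) (b := C)).ultrafilter_le_nhds
      (U.map fun N => L N f) (tendsto_principal.2 (Eventually.of_forall hmem))
    exact ⟨a, ha⟩
  let S : Submodule ℝ (X → ℝ) :=
    { carrier := {f | ∃ C, ∀ x, |f x| ≤ C}
      zero_mem' := ⟨0, by simp⟩
      add_mem' := by
        rintro f g ⟨C, hC⟩ ⟨D, hD⟩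
        exact ⟨C + D, fun x => (abs_add_le _ _).trans (add_le_add (hC x) (hD x))⟩
      smul_mem' := by
        rintro c f ⟨C, hC⟩
        refine ⟨|c| * C, fun x => ?_⟩
        simp only [Pi.smul_apply, smul_eq_mul, abs_mul]
        exact mul_le_mul_of_nonneg_left (hC x) (abs_nonneg _) }
  choose! φ hφ using hlim
  let l : S →ₗ[ℝ] ℝ :=
    { toFun := fun f => φ f
      map_add' := fun f g => tendsto_nhds_unique (hφ _ (f + g).2) (by
        simpa using (hφ _ f.2).add (hφ _ g.2))
      map_smul' := fun c f => tendsto_nhds_unique (hφ _ (c • f).2) (by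
        simpa using (hφ _ f.2).const_mul c) }
  obtain ⟨m, hml⟩ := l.exists_extend
  have hm : ∀ (f : X → ℝ) (C : ℝ), (∀ x, |f x| ≤ C) →
      Tendsto (fun N => L N f) U (𝓝 (m f)) := by
    intro f C hC
    have h : m f = φ f := DFunLike.congr_fun hml (⟨f, C, hC⟩ : S)
    rw [h]
    exact hφ f ⟨C, hC⟩
  refine ⟨m, ⟨fun f C h0 hC => ?_, ?_⟩, hm⟩
  · exact ge_of_tendsto' (hm f C fun x => abs_le.2 ⟨by linarith [h0 x, hC x], hC x⟩)
      fun N => (hL N).nonneg f C h0 hC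
  · have h := hm (fun _ => 1) 1 (by simp)
    simp only [(hL _).one] at h
    exact tendsto_nhds_unique h tendsto_const_nhds

/-- Averaging over a nonempty finite family. -/
noncomputable def expectMean {X K : Type*} (s : Finset K) (π : K → X) : (X → ℝ) →ₗ[ℝ] ℝ where
  toFun f := 𝔼 i ∈ s, f (π i)
  map_add' f g := by simp [Finset.expect_add_distrib]
  map_smul' c f := by simp [Finset.mul_expect]

theorem isMean_expectMean {X K : Type*} {s : Finset K} (hs : s.Nonempty) (π : K → X) :
    IsMean (expectMean s π) :=
  ⟨fun _ _ h0 _ => Finset.expect_nonneg fun i _ => h0 (π i), by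
    simp [expectMean, Finset.expect_const hs]⟩

theorem abs_expect_shift_le {H : Type*} [Group H] [DecidableEq H] {Φ : ℕ → Finset H}
    (hΦ : IsLeftFolner Φ) (g : H) {η : ℝ} (hη : 0 < η) :
    ∀ᶠ N in atTop, ∀ φ : H → ℝ, (∀ x, |φ x| ≤ 1) →
      |(𝔼 a ∈ Φ N, φ (g * a)) - 𝔼 a ∈ Φ N, φ a| ≤ η := by
  filter_upwards [(hΦ.2 g).eventually (lt_mem_nhds (show 1 - η / 2 < 1 by linarith))]
    with N hN φ hφ
  have hc : (0 : ℝ) < (Φ N).card := by exact_mod_cast (hΦ.1 N).card_pos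
  set W := Φ N
  set V := W.image (fun x => g * x) with hV
  have hVc : V.card = W.card := Finset.card_image_of_injective _ (mul_right_injective g)
  have hsum : ∑ a ∈ W, φ (g * a) = ∑ b ∈ V, φ b := by
    rw [hV, Finset.sum_image fun x _ y _ h => mul_left_cancel h]
  have h1 := Finset.sum_inter_add_sum_sdiff V W φ
  have h2 := Finset.sum_inter_add_sum_sdiff W V φ
  have hb : ∀ T : Finset H, |∑ b ∈ T, φ b| ≤ T.card := fun T =>
    (Finset.abs_sum_le_sum_abs _ _).trans ((Finset.sum_le_sum fun i _ => hφ i).trans (by simp))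
  have c1 : ((V \ W).card : ℝ) = W.card - (W ∩ V).card := by
    rw [← hVc, Finset.inter_comm, eq_sub_iff_add_eq]
    exact_mod_cast Finset.card_sdiff_add_card_inter V W
  have c2 : ((W \ V).card : ℝ) = W.card - (W ∩ V).card := by
    rw [eq_sub_iff_add_eq]
    exact_mod_cast Finset.card_sdiff_add_card_inter W V
  rw [lt_div_iff₀ hc] at hN
  rw [Finset.expect_eq_sum_div_card, Finset.expect_eq_sum_div_card, ← sub_div, abs_div,
    abs_of_pos hc, div_le_iff₀ hc, hsum, ← h1, ← h2, Finset.inter_comm V W, add_sub_add_left_eq_sub]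
  refine (abs_sub _ _).trans ?_
  linarith [hb (V \ W), hb (W \ V)]

/-- The box with all sides equal to `W`. -/
abbrev box (ι : Type*) [DecidableEq ι] [Fintype ι] {G : Type*} (W : Finset G) :
    Finset (ι → G) := Fintype.piFinset fun _ => W

theorem expect_box_eq_update {ι G : Type*} [DecidableEq ι] [Fintype ι] (W : Finset G)
    (hW : W.Nonempty) (j : ι) (φ : (ι → G) → ℝ) :
    𝔼 a ∈ box ι W, φ a = 𝔼 b ∈ W, 𝔼 a ∈ box ι W, φ (Function.update a j b) := by
  have h1 : 𝔼 a ∈ box ι W, φ a = 𝔼 _b ∈ W, 𝔼 a ∈ box ι W, φ a := by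
    rw [Finset.expect_const hW]
  rw [h1, ← Finset.expect_product', ← Finset.expect_product']
  refine Finset.expect_nbij' (fun p => (p.2 j, Function.update p.2 j p.1))
    (fun p => (p.2 j, Function.update p.2 j p.1)) ?_ ?_ ?_ ?_ ?_
  · rintro ⟨b, a⟩ h
    simp only [Finset.mem_product, Fintype.mem_piFinset] at h ⊢
    refine ⟨h.2 j, fun i => ?_⟩
    rcases eq_or_ne i j with rfl | hij
    · simpa using h.1
    · simpa [hij] using h.2 i
  · rintro ⟨b, a⟩ h
    simp only [Finset.mem_product, Fintype.mem_piFinset] at h ⊢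
    refine ⟨h.2 j, fun i => ?_⟩
    rcases eq_or_ne i j with rfl | hij
    · simpa using h.1
    · simpa [hij] using h.2 i
  all_goals
    rintro ⟨b, a⟩ -
    simp

section Coordinates

variable {ι G : Type*} [DecidableEq ι] [Group G]

/-- The element agreeing with `h` on `t` and trivial off `t`. -/
def restr (t : Finset ι) (h : ι → G) : ι → G := fun i => if i ∈ t then h i else 1

@[simp] theorem restr_empty (h : ι → G) : restr ∅ h = 1 := by
  ext; simp [restr]

theorem restr_mulSingle_mul_of_notMem {t : Finset ι} {j : ι} (hj : j ∉ t) (g : G) (h : ι → G) :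
    restr t (Pi.mulSingle j g * h) = restr t h := by
  ext i
  by_cases hi : i ∈ t
  · have : i ≠ j := fun e => hj (e ▸ hi)
    simp [restr, this]
  · simp [restr, hi]

theorem restr_update_of_notMem {t : Finset ι} {j : ι} (hj : j ∉ t) (g : G) (h : ι → G) :
    restr t (Function.update h j g) = restr t h := by
  ext i
  by_cases hi : i ∈ t
  · have : i ≠ j := fun e => hj (e ▸ hi)
    simp [restr, this]
  · simp [restr, hi]

theorem restr_insert {t : Finset ι} {j : ι} (hj : j ∉ t) (h : ι → G) :
    restr (insert j t) h = Pi.mulSingle j (h j) * restr t h := by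
  ext i
  by_cases hi : i = j
  · subst hi
    simp [restr, hj]
  · simp [restr, hi]

theorem restr_commute_mulSingle {t : Finset ι} {j : ι} (hj : j ∉ t) (h : ι → G) (g : G) :
    restr t h * Pi.mulSingle j g = Pi.mulSingle j g * restr t h := by
  ext i
  by_cases hi : i = j
  · subst hi
    simp [restr, hj]
  · simp [hi]

theorem restr_mul_restr_inv {t s : Finset ι} (hts : t ⊆ s) (a a' : ι → G) :
    restr t (a' * a⁻¹) * restr s a = restr t a' * restr (s \ t) a := by
  ext i
  by_cases hi : i ∈ t
  · simp [restr, hi, hts hi]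
  · simp [restr, hi]

variable [Fintype ι]

theorem abs_expect_box_shift_le [DecidableEq G] {Φ : ℕ → Finset G} (hΦ : IsLeftFolner Φ) (j : ι)
    (g : G) {η : ℝ} (hη : 0 < η) :
    ∀ᶠ N in atTop, ∀ φ : (ι → G) → ℝ, (∀ x, |φ x| ≤ 1) →
      |(𝔼 a ∈ box ι (Φ N), φ ((Pi.mulSingle j g : ι → G) * a)) - 𝔼 a ∈ box ι (Φ N), φ a| ≤ η := by
  filter_upwards [abs_expect_shift_le hΦ g hη] with N hN φ hφ
  rw [expect_box_eq_update _ (hΦ.1 N) j fun a => φ ((Pi.mulSingle j g : ι → G) * a),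
    expect_box_eq_update _ (hΦ.1 N) j φ]
  refine le_of_eq_of_le ?_ (hN (fun b => 𝔼 a ∈ box ι (Φ N), φ (Function.update a j b))
    fun b => abs_expect_le _ zero_le_one fun a _ => hφ _)
  congr! 7 with b _ a _
  ext i
  rcases eq_or_ne i j with rfl | hij <;> simp [*]

end Coordinates

section Control

variable {ι G X : Type*} [DecidableEq ι] [Fintype ι] [Group G] [MulAction (ι → G) X]

/-- Invariance, on bounded functions, of a functional under an action. -/
def IsInvariant (H : Type*) {X : Type*} [SMul H X] (m : (X → ℝ) →ₗ[ℝ] ℝ) : Prop :=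
  ∀ (f : X → ℝ) (C : ℝ) (g : H), (∀ x, |f x| ≤ C) → m (fun x => f (g • x)) = m f

/-- The box norm of `q` in the directions `s` at scale `W`, raised to the power `2 ^ #s`. -/
noncomputable def boxNorm (m : (X → ℝ) →ₗ[ℝ] ℝ) (W : Finset G) (s : Finset ι) (q : X → ℝ) : ℝ :=
  𝔼 a ∈ box ι W, 𝔼 a' ∈ box ι W,
    m (fun x => ∏ t ∈ s.powerset, q ((restr t a' * restr (s \ t) a) • x))

theorem boxNorm_empty (m : (X → ℝ) →ₗ[ℝ] ℝ) {W : Finset G} (hW : W.Nonempty) (q : X → ℝ) :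
    boxNorm (ι := ι) m W ∅ q = m q := by
  have h : (box ι W).Nonempty := Fintype.piFinset_nonempty.2 fun _ => hW
  simp [boxNorm, Finset.expect_const h]

theorem boxNorm_insert (m : (X → ℝ) →ₗ[ℝ] ℝ) {W : Finset G} (hW : W.Nonempty) {s : Finset ι}
    {j : ι} (hj : j ∉ s) (q : X → ℝ) :
    boxNorm m W (insert j s) q = 𝔼 b ∈ W, 𝔼 b' ∈ W, boxNorm m W s fun x =>
      q ((Pi.mulSingle j b : ι → G) • x) * q ((Pi.mulSingle j b' : ι → G) • x) := by
  unfold boxNorm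
  rw [expect_box_eq_update W hW j]
  refine Finset.expect_congr rfl fun b _ => Eq.trans ?_ (Finset.expect_comm _ _ _)
  refine Finset.expect_congr rfl fun a _ => ?_
  rw [expect_box_eq_update W hW j]
  refine Finset.expect_congr rfl fun b' _ => Finset.expect_congr rfl fun a' _ => ?_
  congr 1
  ext x
  rw [Finset.prod_powerset_insert hj, ← Finset.prod_mul_distrib]
  refine Finset.prod_congr rfl fun t ht => ?_
  have hts := Finset.mem_powerset.1 ht
  have hjt : j ∉ t := fun h => hj (hts h)
  have hd : j ∉ s \ t := fun h => hj (Finset.mem_sdiff.1 h).1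
  rw [Finset.insert_sdiff_of_notMem _ hjt, Finset.insert_sdiff_insert,
    Finset.sdiff_insert_of_notMem hj, restr_insert hd, restr_insert hjt,
    restr_update_of_notMem hjt, restr_update_of_notMem hd,
    Function.update_self, Function.update_self, ← mul_assoc, restr_commute_mulSingle hjt,
    mul_assoc, mul_assoc, mul_smul, mul_smul (Pi.mulSingle j b' : ι → G)]

theorem IsMean.sq_mul_expect_le {m : (X → ℝ) →ₗ[ℝ] ℝ} (hm : IsMean m) {K : Type*} (s : Finset K)
    {b : X → ℝ} (hb : ∀ x, |b x| ≤ 1) {R : K → X → ℝ} (hR : ∀ i x, |R i x| ≤ 1) :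
    m (fun x => b x * 𝔼 i ∈ s, R i x) ^ 2 ≤ 𝔼 i ∈ s, 𝔼 i' ∈ s, m (fun x => R i x * R i' x) := by
  have hE : ∀ x, |𝔼 i ∈ s, R i x| ≤ 1 := fun x => abs_expect_le _ zero_le_one fun i _ => hR i x
  have h1 : m (fun x => (𝔼 i ∈ s, R i x) ^ 2) =
      𝔼 i ∈ s, 𝔼 i' ∈ s, m (fun x => R i x * R i' x) := by
    simp only [← map_expect]
    congr 1
    ext x
    rw [sq, Finset.expect_mul_expect]
  rw [← h1]
  refine (hm.sq_le fun x => abs_mul_le_one (hb x) (hE x)).trans ?_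
  refine hm.mono (C := 1) (fun x => ?_) (fun x => ?_) fun x => ?_
  · rw [abs_pow]
    exact pow_le_one₀ (abs_nonneg _) (abs_mul_le_one (hb x) (hE x))
  · rw [abs_pow]
    exact pow_le_one₀ (abs_nonneg _) (hE x)
  · rw [mul_pow]
    exact mul_le_of_le_one_left (sq_nonneg _) ((sq_le_one_iff_abs_le_one _).2 (hb x))

theorem pow_expect_le_boxNorm [DecidableEq G] {Φ : ℕ → Finset G} (hΦ : IsLeftFolner Φ)
    {m : (X → ℝ) →ₗ[ℝ] ℝ} (hm : IsMean m) (hinv : IsInvariant (ι → G) m) (M : ℕ)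
    (s : Finset ι) {η : ℝ} (hη : 0 < η) :
    ∀ᶠ N in atTop, ∀ (y : ι → G) (q : X → ℝ) (b : ι → (ι → G) → X → ℝ),
      (∀ x, |q x| ≤ 1) → (∀ i h x, |b i h x| ≤ 1) →
      (∀ i ∈ s, ∀ g h x, b i (Pi.mulSingle i g * h) x = b i h x) →
      (𝔼 h ∈ box ι (Φ N), m (fun x => q (restr s (h * y) • x) * ∏ i ∈ s, b i (h * y) x))
        ^ (2 ^ s.card) ≤ boxNorm m (Φ M) s q + η := by
  have hne : ∀ N, (box ι (Φ N)).Nonempty := fun N =>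
    Fintype.piFinset_nonempty.2 fun _ => hΦ.1 N
  induction s using Finset.induction_on generalizing η with
  | empty =>
    refine Eventually.of_forall fun N y q b _ _ _ => ?_
    simp [boxNorm_empty m (hΦ.1 M), Finset.expect_const (hne N), hη.le]
  | insert j s hj ih =>
    rw [Finset.card_insert_of_notMem hj]
    set P := 2 ^ s.card with hP
    have hP0 : (0 : ℝ) < 2 ^ (s.card + 1) := by positivity
    filter_upwards [ih (half_pos hη), (Finset.eventually_all (Φ M)).2 fun g _ =>
      abs_expect_box_shift_le (ι := ι) hΦ j g (div_pos (half_pos hη) hP0)]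
      with N hN hshift y q b hq hb hbi
    set ψ : (ι → G) → ℝ := fun h =>
      m (fun x => q (restr (insert j s) h • x) * ∏ i ∈ insert j s, b i h x) with hψ
    have hψ1 : ∀ h, |ψ h| ≤ 1 := fun h => hm.abs_le fun x =>
      abs_mul_le_one (hq _) (abs_prod_le_one _ fun i _ => hb i h x)
    let R : (ι → G) → G → X → ℝ := fun h a x =>
      q (restr (insert j s) (Pi.mulSingle j a * h) • x) *
        ∏ i ∈ s, b i (Pi.mulSingle j a * h) x
    have hR : ∀ h a x, |R h a x| ≤ 1 := fun h a x =>
      abs_mul_le_one (hq _) (abs_prod_le_one _ fun i _ => hb i _ x)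
    let q' : G → G → X → ℝ := fun a a' x =>
      q ((Pi.mulSingle j a : ι → G) • x) * q ((Pi.mulSingle j a' : ι → G) • x)
    let b' : G → G → ι → (ι → G) → X → ℝ := fun a a' i h x =>
      b i (Pi.mulSingle j a * h) ((Pi.mulSingle j (h j) : ι → G)⁻¹ • x) *
        b i (Pi.mulSingle j a' * h) ((Pi.mulSingle j (h j) : ι → G)⁻¹ • x)
    have hshiftR : ∀ h a a', m (fun x => R h a x * R h a' x) =
        m (fun x => q' a a' (restr s h • x) * ∏ i ∈ s, b' a a' i h x) := by
      intro h a a'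
      rw [← hinv _ 1 (Pi.mulSingle j (h j) : ι → G)⁻¹ fun x =>
        abs_mul_le_one (hR h a x) (hR h a' x)]
      have key : ∀ (c : G) (x : X), (restr (insert j s) (Pi.mulSingle j c * h)) •
          ((Pi.mulSingle j (h j) : ι → G)⁻¹ • x) = (Pi.mulSingle j c : ι → G) • restr s h • x := by
        intro c x
        rw [smul_smul, smul_smul]
        congr 1
        rw [restr_insert hj, restr_mulSingle_mul_of_notMem hj, mul_inv_eq_iff_eq_mul, mul_assoc,
          restr_commute_mulSingle hj, ← mul_assoc, ← Pi.mulSingle_mul]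
        simp
      simp only [R, q', b', key, Finset.prod_mul_distrib]
      congr 1
      ext x
      ring
    set Z := 𝔼 h ∈ box ι (Φ N), ψ (h * y)
    set Z' := 𝔼 a ∈ Φ M, 𝔼 h ∈ box ι (Φ N), ψ ((Pi.mulSingle j a : ι → G) * (h * y)) with hZ'
    have hZ1 : |Z| ≤ 1 := abs_expect_le _ zero_le_one fun h _ => hψ1 _
    have hZ'1 : |Z'| ≤ 1 := abs_expect_le _ zero_le_one fun a _ =>
      abs_expect_le _ zero_le_one fun h _ => hψ1 _
    have hclose : |Z - Z'| ≤ η / 2 / 2 ^ (s.card + 1) := by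
      have h1 : Z - Z' = 𝔼 a ∈ Φ M,
          (Z - 𝔼 h ∈ box ι (Φ N), ψ ((Pi.mulSingle j a : ι → G) * (h * y))) := by
        rw [Finset.expect_sub_distrib, Finset.expect_const (hΦ.1 M)]
      rw [h1]
      refine abs_expect_le _ (by positivity) fun a ha => ?_
      rw [abs_sub_comm]
      simpa only [mul_assoc] using hshift a ha (fun h => ψ (h * y)) fun h => hψ1 _
    have hpow : Z ^ 2 ^ (s.card + 1) ≤ Z' ^ 2 ^ (s.card + 1) + η / 2 := by
      have h1 := abs_pow_sub_pow_le (n := 2 ^ (s.card + 1)) (a := Z) (b := Z')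
      have h2 : max |Z| |Z'| ^ (2 ^ (s.card + 1) - 1) ≤ 1 :=
        pow_le_one₀ (le_max_of_le_left (abs_nonneg _)) (max_le hZ1 hZ'1)
      rw [le_div_iff₀ hP0] at hclose
      push_cast at h1
      have h3 := mul_le_mul hclose h2 (pow_nonneg (le_max_of_le_left (abs_nonneg _)) _)
        (half_pos hη).le
      linarith [le_abs_self (Z ^ 2 ^ (s.card + 1) - Z' ^ 2 ^ (s.card + 1))]
    have hZ'b : Z' = 𝔼 h ∈ box ι (Φ N),
        m (fun x => b j (h * y) x * 𝔼 a ∈ Φ M, R (h * y) a x) := by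
      rw [hZ', Finset.expect_comm]
      refine Finset.expect_congr rfl fun h _ => ?_
      simp only [Finset.mul_expect, map_expect]
      refine Finset.expect_congr rfl fun a _ => ?_
      simp only [hψ, R, Finset.prod_insert hj, hbi j (Finset.mem_insert_self _ _)]
      congr 1
      ext x
      ring
    have hZ'sq : Z' ^ 2 ≤ 𝔼 a ∈ Φ M, 𝔼 a' ∈ Φ M, 𝔼 h ∈ box ι (Φ N),
        m (fun x => q' a a' (restr s (h * y) • x) * ∏ i ∈ s, b' a a' i (h * y) x) := by
      rw [hZ'b]
      refine (expect_sq_le _ _).trans ?_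
      refine (Finset.expect_le_expect fun h _ =>
        hm.sq_mul_expect_le (Φ M) (hb j (h * y)) (hR (h * y))).trans_eq ?_
      simp only [hshiftR]
      rw [Finset.expect_comm]
      exact Finset.expect_congr rfl fun a _ => Finset.expect_comm _ _ _
    refine hpow.trans ?_
    rw [boxNorm_insert m (hΦ.1 M) hj]
    have hfin : Z' ^ 2 ^ (s.card + 1) ≤ 𝔼 a ∈ Φ M, 𝔼 a' ∈ Φ M,
        (boxNorm m (Φ M) s (q' a a') + η / 2) := by
      rw [pow_succ' 2, pow_mul]
      refine (pow_le_pow_left₀ (sq_nonneg _) hZ'sq _).trans ?_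
      refine (expect_pow_two_pow_le _ _ _).trans (Finset.expect_le_expect fun a _ => ?_)
      refine (expect_pow_two_pow_le _ _ _).trans (Finset.expect_le_expect fun a' _ => ?_)
      refine hN y (q' a a') (b' a a') (fun x => abs_mul_le_one (hq _) (hq _))
        (fun i h x => abs_mul_le_one (hb _ _ _) (hb _ _ _)) fun i hi g h x => ?_
      have hij : i ≠ j := fun e => hj (e ▸ hi)
      have hc : ∀ c : G, (Pi.mulSingle j c : ι → G) * (Pi.mulSingle i g * h)
          = Pi.mulSingle i g * (Pi.mulSingle j c * h) := fun c => by
        rw [← mul_assoc, ← mul_assoc,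
          (Pi.mulSingle_commute (f := fun _ : ι => G) hij.symm c g).eq]
      simp only [b', hc, hbi i (Finset.mem_insert_of_mem hi)]
      simp [hij.symm]
    simp only [Finset.expect_add_distrib, Finset.expect_const (hΦ.1 M)] at hfin
    linarith

end Control

theorem convexHull_abs_le_one {X : Type*} {A : Set (X → ℝ)} (hA : ∀ e ∈ A, ∀ x, |e x| ≤ 1) :
    ∀ q ∈ convexHull ℝ A, ∀ x, |q x| ≤ 1 := by
  intro q hq
  refine convexHull_min (t := {q : X → ℝ | ∀ x, |q x| ≤ 1}) hA ?_ hq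
  intro u hu v hv a b ha hb hab x
  simp only [Pi.add_apply, Pi.smul_apply, smul_eq_mul]
  calc |a * u x + b * v x| ≤ a * |u x| + b * |v x| := by
        refine (abs_add_le _ _).trans_eq ?_
        rw [abs_mul, abs_mul, abs_of_nonneg ha, abs_of_nonneg hb]
    _ ≤ a * 1 + b * 1 := add_le_add (mul_le_mul_of_nonneg_left (hu x) ha)
        (mul_le_mul_of_nonneg_left (hv x) hb)
    _ = 1 := by linarith

theorem convexHull_map_le {E : Type*} [AddCommGroup E] [Module ℝ E] (l : E →ₗ[ℝ] ℝ) {A : Set E}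
    {c : ℝ} (hA : ∀ e ∈ A, l e ≤ c) : ∀ q ∈ convexHull ℝ A, l q ≤ c := fun _ hq =>
  convexHull_min (t := {q | l q ≤ c}) hA (convex_halfSpace_le l.isLinear c) hq

/-- A bounded family of functions is weakly Cauchy for the semi-inner product `m (u * v)` if its
correlations with a bounded function `q` are dominated by `ℓ q` for a bounded functional `ℓ` (a dual
function of `q`) along which the family is Cauchy. -/
theorem eventually_sub_lt_of_dual {X P : Type*} {m : (X → ℝ) →ₗ[ℝ] ℝ} (hm : IsMean m)
    {F : Filter P} {D : P → X → ℝ} (hD : ∀ p x, |D p x| ≤ 1) {k : ℕ} (hk : Even k)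
    (H : ∀ q : X → ℝ, (∀ x, |q x| ≤ 1) → ∃ l : (X → ℝ) →ₗ[ℝ] ℝ,
      (∀ (u : X → ℝ) (C : ℝ), (∀ x, |u x| ≤ C) → l u ^ 2 ≤ m (u * u)) ∧
      (∀ η > 0, ∀ᶠ p in F, m (q * D p) ^ k ≤ l q + η) ∧
      Tendsto (fun p : P × P => l (D p.1) - l (D p.2)) (F ×ˢ F) (𝓝 0))
    {f : X → ℝ} (hf : ∀ x, |f x| ≤ 1) {ε : ℝ} (hε : 0 < ε) :
    ∀ᶠ p : P × P in F ×ˢ F, m (f * D p.1) - m (f * D p.2) < 2 * ε := by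
  by_contra hcon
  have hfreq : ∃ᶠ p : P × P in F ×ˢ F, 2 * ε ≤ m (f * D p.1) - m (f * D p.2) := by
    simpa only [Filter.not_eventually, not_lt] using hcon
  set e : P × P → X → ℝ := fun p => (1 / 2 : ℝ) • (D p.1 - D p.2) with he
  have he1 : ∀ p x, |e p x| ≤ 1 := fun p x => by
    have h1 := abs_le.1 (hD p.1 x)
    have h2 := abs_le.1 (hD p.2 x)
    simp only [he, Pi.smul_apply, Pi.sub_apply, smul_eq_mul]
    exact abs_le.2 ⟨by linarith, by linarith⟩
  have hme : ∀ (u : X → ℝ) p, m (u * e p) = (m (u * D p.1) - m (u * D p.2)) / 2 := fun u p => by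
    simp only [he, mul_smul_comm, mul_sub, map_smul, map_sub, smul_eq_mul]
    ring
  let C : Set (P × P) → Set (X → ℝ) := fun U =>
    convexHull ℝ {g | ∃ p ∈ U, g = e p ∧ ε ≤ m (f * e p)}
  have hCmono : ∀ {U V : Set (P × P)}, U ⊆ V → C U ⊆ C V := fun hUV =>
    convexHull_mono fun _ ⟨p, hp, h⟩ => ⟨p, hUV hp, h⟩
  have hCmap : ∀ (l : (X → ℝ) →ₗ[ℝ] ℝ) {U : Set (P × P)} {c : ℝ}, (∀ p ∈ U, l (e p) ≤ c) →
      ∀ q ∈ C U, l q ≤ c := fun l U c h => convexHull_map_le l (by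
    rintro _ ⟨p, hp, rfl, -⟩
    exact h p hp)
  have hC1 : ∀ {U : Set (P × P)}, ∀ q ∈ C U, ∀ x, |q x| ≤ 1 :=
    convexHull_abs_le_one (by rintro _ ⟨p, -, rfl, -⟩; exact he1 p)
  have hsq1 : ∀ u : X → ℝ, (∀ x, |u x| ≤ 1) → m (u * u) ≤ 1 := fun u hu =>
    (le_abs_self _).trans (hm.abs_le fun x => abs_mul_le_one (hu x) (hu x))
  have hsq0 : ∀ u : X → ℝ, (∀ x, |u x| ≤ 1) → 0 ≤ m (u * u) := fun u hu =>
    hm.nonneg _ 1 (fun x => mul_self_nonneg _)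
      fun x => (le_abs_self _).trans (abs_mul_le_one (hu x) (hu x))
  have hCε : ∀ {U : Set (P × P)}, ∀ q ∈ C U, ε ^ 2 ≤ m (q * q) := by
    intro U q hq
    have h1 : -m (f * q) ≤ -ε := convexHull_map_le (-(m ∘ₗ LinearMap.mulLeft ℝ f)) (by
      rintro _ ⟨p, -, rfl, h⟩
      simpa using h) q hq
    have h2 := hm.sq_mul_le hf (hC1 q hq)
    simp only [sq (f _), sq (q _)] at h2
    have h3 : m (f * q) ^ 2 ≤ m (f * f) * m (q * q) := h2
    nlinarith [hsq1 f hf, hsq0 q (hC1 q hq)]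
  have hCne : ∀ U ∈ F ×ˢ F, (C U).Nonempty := by
    intro U hU
    obtain ⟨p, hp, hpU⟩ := (hfreq.and_eventually hU).exists
    exact ⟨e p, subset_convexHull ℝ _ ⟨p, hpU, rfl, by rw [hme]; linarith⟩⟩
  set S : Set ℝ := {ρ | ∃ U ∈ F ×ˢ F, ∀ q ∈ C U, ρ ≤ m (q * q)}
  have hSb : BddAbove S := ⟨1, by
    rintro ρ ⟨U, hU, h⟩
    obtain ⟨q, hq⟩ := hCne U hU
    exact (h q hq).trans (hsq1 q (hC1 q hq))⟩
  have hSne : S.Nonempty := ⟨ε ^ 2, Set.univ, univ_mem, fun q hq => hCε q hq⟩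
  set r := sSup S
  obtain ⟨τ, hτ0, hτε, hτk⟩ : ∃ τ : ℝ, 0 < τ ∧ τ < ε ∧ 2 * τ < (ε ^ 2 / 4) ^ k := by
    have h : 0 < min ε ((ε ^ 2 / 4) ^ k / 2) := lt_min hε (by positivity)
    obtain ⟨τ, h0, h1⟩ := exists_between h
    exact ⟨τ, h0, h1.trans_le (min_le_left _ _), by linarith [h1.trans_le (min_le_right _ _)]⟩
  set δ := τ ^ 2 / 8 with hδ
  have hδ0 : 0 < δ := by positivity
  obtain ⟨ρ, ⟨U₀, hU₀, hρ⟩, hρr⟩ := exists_lt_of_lt_csSup hSne (sub_lt_self r hδ0)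
  have hmin : ∀ U ∈ F ×ˢ F, ∃ q ∈ C U, m (q * q) < r + δ := by
    intro U hU
    by_contra! h
    linarith [le_csSup hSb (show r + δ ∈ S from ⟨U, hU, h⟩)]
  obtain ⟨q, hq, hqr⟩ := hmin U₀ hU₀
  obtain ⟨l, hl2, hlq, hlD⟩ := H q (hC1 q hq)
  have hlq' := hlq (τ / 2) (by positivity)
  obtain ⟨U, hU, hUall⟩ := (hlD.eventually (gt_mem_nhds hτ0)).and
    ((hlq'.prod_mk hlq')) |>.exists_mem
  obtain ⟨q', hq', hqr'⟩ := hmin (U₀ ∩ U) (inter_mem hU₀ hU)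
  have hq'0 : q' ∈ C U₀ := hCmono Set.inter_subset_left hq'
  have hw : (1 / 2 : ℝ) • q + (1 / 2 : ℝ) • q' ∈ C U₀ :=
    convex_convexHull ℝ _ hq hq'0 (by norm_num) (by norm_num) (by norm_num)
  have hw' := hρ _ hw
  have hpar : m ((q - q') * (q - q')) = m (q * q) + m (q' * q') - 2 * m (q * q') := by
    have : (q - q') * (q - q') = q * q + q' * q' - (2 : ℝ) • (q * q') := by
      ext x; simp; ring
    rw [this, map_sub, map_add, map_smul, smul_eq_mul]
  have hpar' : m (((1 / 2 : ℝ) • q + (1 / 2 : ℝ) • q') * ((1 / 2 : ℝ) • q + (1 / 2 : ℝ) • q')) =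
      (m (q * q) + m (q' * q') + 2 * m (q * q')) / 4 := by
    have : ((1 / 2 : ℝ) • q + (1 / 2 : ℝ) • q') * ((1 / 2 : ℝ) • q + (1 / 2 : ℝ) • q') =
        (1 / 4 : ℝ) • (q * q + q' * q' + (2 : ℝ) • (q * q')) := by
      ext x; simp; ring
    rw [this, map_smul, map_add, map_add, map_smul, smul_eq_mul, smul_eq_mul]
    ring
  have hdist : m ((q - q') * (q - q')) ≤ τ ^ 2 := by linarith
  have hlsub : l (q - q') ≤ τ :=
    (le_abs_self _).trans (abs_le_of_sq_le_sq ((hl2 (q - q') 2 fun x => (abs_sub _ _).trans (by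
      linarith [hC1 q hq x, hC1 q' hq' x])).trans hdist) hτ0.le)
  have hlq'' : l q' ≤ τ / 2 := hCmap l (fun p hp => by
    have h := (hUall p hp.2).1
    simp only [he, map_smul, map_sub, smul_eq_mul]
    linarith) q' hq'
  have hlqle : l q ≤ τ + τ / 2 := by
    rw [map_sub] at hlsub
    linarith
  have hsmall : ∀ p, m (q * D p) ^ k ≤ l q + τ / 2 → |m (q * D p)| < ε ^ 2 / 4 := by
    intro p hp
    by_contra! h
    have h1 := pow_le_pow_left₀ (by positivity) h k
    rw [hk.pow_abs] at h1
    linarith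
  have hqq' : m (q * q') ≤ ε ^ 2 / 4 := hCmap (m ∘ₗ LinearMap.mulLeft ℝ q) (fun p hp => by
    have h := (hUall p hp.2).2
    have h1 := abs_lt.1 (hsmall _ h.1)
    have h2 := abs_lt.1 (hsmall _ h.2)
    simp only [LinearMap.comp_apply, LinearMap.mulLeft_apply, hme]
    linarith) q' hq'
  have := hCε q hq
  have := hCε q' hq'
  nlinarith

theorem tendsto_sub_of_dual {X P : Type*} {m : (X → ℝ) →ₗ[ℝ] ℝ} (hm : IsMean m)
    {F : Filter P} {D : P → X → ℝ} (hD : ∀ p x, |D p x| ≤ 1) {k : ℕ} (hk : Even k)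
    (H : ∀ q : X → ℝ, (∀ x, |q x| ≤ 1) → ∃ l : (X → ℝ) →ₗ[ℝ] ℝ,
      (∀ (u : X → ℝ) (C : ℝ), (∀ x, |u x| ≤ C) → l u ^ 2 ≤ m (u * u)) ∧
      (∀ η > 0, ∀ᶠ p in F, m (q * D p) ^ k ≤ l q + η) ∧
      Tendsto (fun p : P × P => l (D p.1) - l (D p.2)) (F ×ˢ F) (𝓝 0))
    {f : X → ℝ} (hf : ∀ x, |f x| ≤ 1) :
    Tendsto (fun p : P × P => m (f * D p.1) - m (f * D p.2)) (F ×ˢ F) (𝓝 0) := by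
  rw [Metric.tendsto_nhds]
  intro ε hε
  filter_upwards [eventually_sub_lt_of_dual hm hD hk H hf (half_pos hε),
    eventually_sub_lt_of_dual hm hD hk H (f := -f) (by simpa using hf) (half_pos hε)] with p h1 h2
  rw [neg_mul, neg_mul, map_neg, map_neg] at h2
  rw [Real.dist_0_eq_abs, abs_lt]
  constructor <;> linarith

/-- The mean along windows `box * box⁻¹` of a Følner sequence is right invariant. -/
theorem exists_right_invariant_mean {ι G : Type*} [DecidableEq ι] [Fintype ι] [Group G]
    [DecidableEq G] {Φ : ℕ → Finset G} (hΦ : IsLeftFolner Φ) :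
    ∃ (l : ((ι → G) → ℝ) →ₗ[ℝ] ℝ) (U : Ultrafilter ℕ), IsMean l ∧
      (∀ (φ : (ι → G) → ℝ) (g : ι → G), (∀ h, |φ h| ≤ 1) → l (fun h => φ (h * g)) = l φ) ∧
      ∀ φ : (ι → G) → ℝ, (∀ h, |φ h| ≤ 1) →
        Tendsto (fun N => 𝔼 a ∈ box ι (Φ N), 𝔼 a' ∈ box ι (Φ N), φ (a' * a⁻¹)) U (𝓝 (l φ)) := by
  have hne : ∀ N, (box ι (Φ N)).Nonempty := fun N => Fintype.piFinset_nonempty.2 fun _ => hΦ.1 N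
  have hU : (hyperfilter ℕ : Filter ℕ) ≤ atTop := Nat.cofinite_eq_atTop ▸ hyperfilter_le_cofinite
  obtain ⟨l, hl, hlim⟩ := exists_mean_tendsto
    (fun N => expectMean (box ι (Φ N) ×ˢ box ι (Φ N)) fun p => p.2 * p.1⁻¹)
    (fun N => isMean_expectMean ((hne N).product (hne N)) _) (hyperfilter ℕ)
  have hlim' : ∀ φ : (ι → G) → ℝ, (∀ h, |φ h| ≤ 1) →
      Tendsto (fun N => 𝔼 a ∈ box ι (Φ N), 𝔼 a' ∈ box ι (Φ N), φ (a' * a⁻¹))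
        (hyperfilter ℕ) (𝓝 (l φ)) := by
    intro φ hφ
    simpa only [expectMean, LinearMap.coe_mk, AddHom.coe_mk, Finset.expect_product] using
      hlim φ 1 hφ
  refine ⟨l, hyperfilter ℕ, hl, ?_, hlim'⟩
  let S : Subgroup (ι → G) :=
    { carrier := {g | ∀ φ : (ι → G) → ℝ, (∀ h, |φ h| ≤ 1) → l (fun h => φ (h * g)) = l φ}
      one_mem' := fun φ _ => by simp
      mul_mem' := fun {g g'} hg hg' φ hφ => by
        have h := hg (fun h => φ (h * g')) fun h => hφ _
        simp only [mul_assoc] at h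
        rw [h, hg' φ hφ]
      inv_mem' := fun {g} hg φ hφ => by
        have h := hg (fun h => φ (h * g⁻¹)) fun h => hφ _
        simp only [mul_inv_cancel_right] at h
        exact h.symm }
  suffices h : ∀ g, g ∈ S from fun φ g hφ => h g φ hφ
  refine fun g => Subgroup.pi_mem_of_mulSingle_mem g fun j φ hφ => ?_
  refine tendsto_nhds_unique (hlim' (fun h => φ (h * Pi.mulSingle j (g j))) fun h => hφ _) ?_
  refine (hlim' φ hφ).congr_dist ?_
  rw [Metric.tendsto_nhds]
  intro η hη
  filter_upwards [hU (abs_expect_box_shift_le hΦ j (g j)⁻¹ (half_pos hη))] with N hN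
  have h := hN (fun a => 𝔼 a' ∈ box ι (Φ N), φ (a' * a⁻¹))
    fun a => abs_expect_le _ zero_le_one fun _ _ => hφ _
  simp only [mul_inv_rev, Pi.mulSingle_inv, inv_inv] at h
  rw [Real.dist_0_eq_abs, abs_of_nonneg dist_nonneg, dist_comm, Real.dist_eq]
  simp only [mul_assoc]
  linarith

/-- The mean on the skew product with fibers `X` induced by a mean on the base. -/
noncomputable def fiberMean {X K : Type*} (m : (X → ℝ) →ₗ[ℝ] ℝ) (l : (K → ℝ) →ₗ[ℝ] ℝ) :
    ((Σ _ : K, X) → ℝ) →ₗ[ℝ] ℝ where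
  toFun F := l fun h => m fun x => F ⟨h, x⟩
  map_add' u v := by rw [← map_add]; congr 1; ext h; exact map_add m _ _
  map_smul' c u := by rw [RingHom.id_apply, ← map_smul]; congr 1; ext h; exact map_smul m _ _

theorem isMean_fiberMean {X K : Type*} {m : (X → ℝ) →ₗ[ℝ] ℝ} {l : (K → ℝ) →ₗ[ℝ] ℝ} (hm : IsMean m)
    (hl : IsMean l) : IsMean (fiberMean m l) where
  nonneg F C h0 hC := hl.nonneg _ C (fun h => hm.nonneg _ C (fun x => h0 _) fun x => hC _)
    fun h => (le_abs_self _).trans (hm.abs_le fun x => abs_le.2 ⟨by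
      linarith [h0 ⟨h, x⟩, hC ⟨h, x⟩], hC _⟩)
  one := by simp [fiberMean, hm.one, hl.one]

theorem isInvariant_fiberMean {H X K : Type*} [SMul H X] {m : (X → ℝ) →ₗ[ℝ] ℝ}
    {l : (K → ℝ) →ₗ[ℝ] ℝ} (hinv : IsInvariant H m) :
    IsInvariant H (fiberMean m l) := fun F C g hF => by
  simp only [fiberMean, LinearMap.coe_mk, AddHom.coe_mk]
  congr 1
  ext h
  exact hinv (fun x => F ⟨h, x⟩) C g fun x => hF _

section Cauchy

universe u v

variable {ι : Type v} {G : Type u} [DecidableEq ι] [Group G]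

/-- The functional dual to `q` built from the box norm in the directions `s`. -/
noncomputable def dualMap {X : Type*} [MulAction (ι → G) X] (m : (X → ℝ) →ₗ[ℝ] ℝ)
    (l : ((ι → G) → ℝ) →ₗ[ℝ] ℝ) (s : Finset ι) (q : X → ℝ) : (X → ℝ) →ₗ[ℝ] ℝ where
  toFun u := l fun h => m (u * fun x => ∏ t ∈ s.powerset.erase ∅, q (restr t h • x))
  map_add' u v := by simp only [add_mul, map_add]; exact map_add l _ _
  map_smul' c u := by simp only [smul_mul_assoc, map_smul]; exact map_smul l _ _

variable {X : Type*} [MulAction (ι → G) X] {m : (X → ℝ) →ₗ[ℝ] ℝ} {l : ((ι → G) → ℝ) →ₗ[ℝ] ℝ}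

theorem dualMap_sq_le (hm : IsMean m) (hl : IsMean l) (s : Finset ι) {q : X → ℝ}
    (hq : ∀ x, |q x| ≤ 1) {u : X → ℝ} {C : ℝ} (hu : ∀ x, |u x| ≤ C) :
    dualMap m l s q u ^ 2 ≤ m (u * u) := by
  have hp : ∀ h x, |∏ t ∈ s.powerset.erase ∅, q (restr t (h : ι → G) • x)| ≤ 1 := fun h x =>
    abs_prod_le_one _ fun t _ => hq _
  have hC : ∀ h x, |(u * fun x => ∏ t ∈ s.powerset.erase ∅, q (restr t (h : ι → G) • x)) x| ≤ C :=
    fun h x => by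
      rw [Pi.mul_apply, abs_mul]
      exact (mul_le_of_le_one_right (abs_nonneg _) (hp h x)).trans (hu x)
  have huu : ∀ x, |(u * u) x| ≤ C * C := fun x => by
    rw [Pi.mul_apply, abs_mul]
    exact mul_self_le_mul_self (abs_nonneg _) (hu x)
  have h0 : 0 ≤ m (u * u) := hm.nonneg _ (C * C) (fun x => mul_self_nonneg _)
    fun x => (le_abs_self _).trans (huu x)
  refine (hl.sq_le fun h => hm.abs_le (hC h)).trans ((le_abs_self _).trans (hl.abs_le fun h => ?_))
  rw [abs_of_nonneg (sq_nonneg _)]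
  refine (hm.sq_mul_le hu (hp h)).trans ?_
  have h1 : m (fun x => u x ^ 2) = m (u * u) := by congr 1; ext x; simp [sq]
  rw [h1]
  refine mul_le_of_le_one_right h0 ((le_abs_self _).trans (hm.abs_le fun x => ?_))
  rw [abs_pow]
  exact pow_le_one₀ (abs_nonneg _) (hp h x)

variable [Fintype ι]

/-- The average over the window `box * y` of the correlations of the functions `f t`, `t ∈ D`, along
the faces of a cube. -/
noncomputable def cubeAvg {X : Type*} [MulAction (ι → G) X] (m : (X → ℝ) →ₗ[ℝ] ℝ)
    (D : Finset (Finset ι)) (f : Finset ι → X → ℝ) (W : Finset G) (y : ι → G) : ℝ :=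
  𝔼 h ∈ box ι W, m (fun x => ∏ t ∈ D, f t (restr t (h * y) • x))

theorem tendsto_boxNorm_dualMap (hinv : IsInvariant (ι → G) m) {Φ : ℕ → Finset G}
    {U : Ultrafilter ℕ} (hm : IsMean m)
    (hlim : ∀ φ : (ι → G) → ℝ, (∀ h, |φ h| ≤ 1) →
        Tendsto (fun N => 𝔼 a ∈ box ι (Φ N), 𝔼 a' ∈ box ι (Φ N), φ (a' * a⁻¹)) U (𝓝 (l φ)))
    (s : Finset ι) {q : X → ℝ} (hq : ∀ x, |q x| ≤ 1) :
    Tendsto (fun N => boxNorm m (Φ N) s q) U (𝓝 (dualMap m l s q q)) := by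
  have hprod : ∀ h : ι → G, (q * fun x => ∏ t ∈ s.powerset.erase ∅, q (restr t h • x)) =
      fun x => ∏ t ∈ s.powerset, q (restr t h • x) := fun h => by
    ext x
    rw [← Finset.mul_prod_erase _ _ (Finset.empty_mem_powerset s)]
    simp
  have hb : ∀ (h : ι → G) x, |∏ t ∈ s.powerset, q (restr t h • x)| ≤ 1 := fun h x =>
    abs_prod_le_one _ fun t _ => hq _
  simp only [dualMap, LinearMap.coe_mk, AddHom.coe_mk, hprod]
  convert hlim (fun h => m (fun x => ∏ t ∈ s.powerset, q (restr t h • x)))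
    fun h => hm.abs_le (hb h) using 1
  ext N
  refine Finset.expect_congr rfl fun a _ => Finset.expect_congr rfl fun a' _ => ?_
  rw [← hinv _ 1 (restr s a) (hb _)]
  congr 1
  ext x
  refine Finset.prod_congr rfl fun t ht => ?_
  rw [← mul_smul, restr_mul_restr_inv (Finset.mem_powerset.1 ht)]

theorem eventually_pow_le_dualMap [DecidableEq G] {Φ : ℕ → Finset G} (hΦ : IsLeftFolner Φ)
    {U : Ultrafilter ℕ} (hm : IsMean m) (hinv : IsInvariant (ι → G) m)
    (hlim : ∀ φ : (ι → G) → ℝ, (∀ h, |φ h| ≤ 1) →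
        Tendsto (fun N => 𝔼 a ∈ box ι (Φ N), 𝔼 a' ∈ box ι (Φ N), φ (a' * a⁻¹)) U (𝓝 (l φ)))
    {D : Finset (Finset ι)} {s : Finset ι} (hs₀ : s.Nonempty) (hs : ∀ t ∈ D, ∃ i ∈ s, i ∉ t)
    {f : Finset ι → X → ℝ} (hf : ∀ t x, |f t x| ≤ 1) {q : X → ℝ} (hq : ∀ x, |q x| ≤ 1)
    {η : ℝ} (hη : 0 < η) :
    ∀ᶠ N in atTop, ∀ y : ι → G, (𝔼 h ∈ box ι (Φ N), m (fun x => q (restr s (h * y) • x) *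
      ∏ t ∈ D, f t (restr t (h * y) • x))) ^ (2 ^ s.card) ≤ dualMap m l s q q + η := by
  obtain ⟨M, hM⟩ := ((tendsto_boxNorm_dualMap hinv hm hlim s hq).eventually
    (gt_mem_nhds (lt_add_of_pos_right _ (half_pos hη)))).exists
  have : Nonempty ι := hs₀.to_type
  choose! c hcs hct using hs
  filter_upwards [pow_expect_le_boxNorm hΦ hm hinv M s (half_pos hη)] with N hN y
  have h := hN y q (fun i h x => ∏ t ∈ D with c t = i, f t (restr t h • x)) hq
    (fun i h x => abs_prod_le_one _ fun t _ => hf _ _) fun i _ g h x =>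
      Finset.prod_congr rfl fun t ht => by
        obtain ⟨htD, rfl⟩ := Finset.mem_filter.1 ht
        rw [restr_mulSingle_mul_of_notMem (hct t htD)]
  simp only [Finset.prod_fiberwise_of_maps_to hcs] at h
  linarith

/-- The average over the window `W * y` correlating with `f s` to `cubeAvg m D f W y`. -/
noncomputable def corrFun (D : Finset (Finset ι)) (s : Finset ι) (f : Finset ι → X → ℝ)
    (W : Finset G) (y : ι → G) : X → ℝ := fun x =>
  𝔼 h ∈ box ι W, ∏ t ∈ D.erase s, f t ((restr t (h * y) * (restr s (h * y))⁻¹) • x)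

theorem abs_corrFun_le {D : Finset (Finset ι)} {s : Finset ι} {f : Finset ι → X → ℝ}
    (hf : ∀ t x, |f t x| ≤ 1) (W : Finset G) (y : ι → G) (x : X) : |corrFun D s f W y x| ≤ 1 :=
  abs_expect_le _ zero_le_one fun _ _ => abs_prod_le_one _ fun _ _ => hf _ _

theorem map_mul_corrFun (hinv : IsInvariant (ι → G) m) {D : Finset (Finset ι)} {s : Finset ι}
    {f : Finset ι → X → ℝ} (hf : ∀ t x, |f t x| ≤ 1) {u : X → ℝ} (hu : ∀ x, |u x| ≤ 1)
    (W : Finset G) (y : ι → G) :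
    m (u * corrFun D s f W y) = 𝔼 h ∈ box ι W, m (fun x => u (restr s (h * y) • x) *
      ∏ t ∈ D.erase s, f t (restr t (h * y) • x)) := by
  have h1 : u * corrFun D s f W y = fun x => 𝔼 h ∈ box ι W,
      u x * ∏ t ∈ D.erase s, f t ((restr t (h * y) * (restr s (h * y))⁻¹) • x) := by
    ext x
    rw [Pi.mul_apply, corrFun, Finset.mul_expect]
  rw [h1, map_expect]
  refine Finset.expect_congr rfl fun h _ => ?_
  rw [← hinv _ 1 (restr s (h * y)) fun x => abs_mul_le_one (hu x)
    (abs_prod_le_one _ fun t _ => hf _ _)]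
  simp only [smul_smul, inv_mul_cancel_right]

theorem map_mul_corrFun_self (hinv : IsInvariant (ι → G) m) {D : Finset (Finset ι)} {s : Finset ι}
    (hs : s ∈ D) {f : Finset ι → X → ℝ} (hf : ∀ t x, |f t x| ≤ 1) (W : Finset G) (y : ι → G) :
    m (f s * corrFun D s f W y) = cubeAvg m D f W y := by
  rw [map_mul_corrFun hinv hf (hf s), cubeAvg]
  refine Finset.expect_congr rfl fun h _ => ?_
  congr 1
  ext x
  exact Finset.mul_prod_erase D (fun t => f t (restr t (h * y) • x)) hs

theorem dualMap_corrFun (hinv : IsInvariant (ι → G) m) (hm : IsMean m)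
    (hright : ∀ (φ : (ι → G) → ℝ) (g : ι → G), (∀ h, |φ h| ≤ 1) → l (fun h => φ (h * g)) = l φ)
    {D : Finset (Finset ι)} (hD : IsLowerSet (D : Set (Finset ι))) {s : Finset ι} (hs : s ∈ D)
    {f : Finset ι → X → ℝ} (hf : ∀ t x, |f t x| ≤ 1) {q : X → ℝ} (hq : ∀ x, |q x| ≤ 1)
    (W : Finset G) (y : ι → G) :
    dualMap m l s q (corrFun D s f W y) = cubeAvg (fiberMean m l) (D.erase s)
      (fun t p => f t p.2 * if t ⊆ s then q (restr (s \ t) p.1 • p.2) else 1) W y := by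
  have h1 : ∀ h' : ι → G,
      m (corrFun D s f W y * fun x => ∏ t ∈ s.powerset.erase ∅, q (restr t h' • x)) =
      𝔼 h ∈ box ι W, m (fun x => (∏ t ∈ s.powerset.erase ∅, q ((restr t h' * restr s (h * y)) • x))
        * ∏ t ∈ D.erase s, f t (restr t (h * y) • x)) := fun h' => by
    rw [mul_comm, map_mul_corrFun hinv hf fun x => abs_prod_le_one _ fun t _ => hq _]
    simp only [smul_smul]
  simp only [dualMap, LinearMap.coe_mk, AddHom.coe_mk, h1, cubeAvg, map_expect]
  refine Finset.expect_congr rfl fun h _ => ?_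
  simp only [fiberMean, LinearMap.coe_mk, AddHom.coe_mk]
  rw [← hright _ (h * y)⁻¹ fun h' => hm.abs_le fun x => abs_mul_le_one
    (abs_prod_le_one _ fun t _ => hq _) (abs_prod_le_one _ fun t _ => hf _ _)]
  congr 1
  ext h'
  congr 1
  ext x
  rw [Finset.prod_mul_distrib, mul_comm]
  congr 1
  rw [Finset.prod_ite, Finset.prod_const_one, mul_one]
  refine Finset.prod_nbij' (fun t => s \ t) (fun t => s \ t) ?_ ?_ ?_ ?_ ?_
  · intro t ht
    simp only [Finset.mem_erase, Finset.mem_powerset, Finset.mem_filter] at ht ⊢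
    refine ⟨⟨fun e => ht.1 ?_, hD Finset.sdiff_subset hs⟩, Finset.sdiff_subset⟩
    rw [← Finset.sdiff_sdiff_eq_self ht.2, e, Finset.sdiff_self]
  · intro t ht
    simp only [Finset.mem_erase, Finset.mem_powerset, Finset.mem_filter] at ht ⊢
    refine ⟨fun e => ht.1.1 ?_, Finset.sdiff_subset⟩
    rw [← Finset.sdiff_sdiff_eq_self ht.2, e, Finset.sdiff_empty]
  · intro t ht
    exact Finset.sdiff_sdiff_eq_self (Finset.mem_powerset.1 (Finset.mem_of_mem_erase ht))
  · intro t ht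
    exact Finset.sdiff_sdiff_eq_self (Finset.mem_filter.1 ht).2
  · intro t ht
    have hts := Finset.mem_powerset.1 (Finset.mem_of_mem_erase ht)
    rw [restr_mul_restr_inv hts, Finset.sdiff_sdiff_eq_self hts]
    simp only [Sigma.smul_mk, smul_smul]

theorem tendsto_cubeAvg_sub {G : Type u} {ι : Type v} [DecidableEq ι] [Fintype ι] [Group G]
    [DecidableEq G] {Φ : ℕ → Finset G} (hΦ : IsLeftFolner Φ)
    {D : Finset (Finset ι)} (hD : IsLowerSet (D : Set (Finset ι)))
    {X : Type max u v} [MulAction (ι → G) X] {m : (X → ℝ) →ₗ[ℝ] ℝ} (hm : IsMean m)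
    (hinv : IsInvariant (ι → G) m) {f : Finset ι → X → ℝ} (hf : ∀ t x, |f t x| ≤ 1) :
    Tendsto (fun p : (ℕ × (ι → G)) × (ℕ × (ι → G)) =>
        cubeAvg m D f (Φ p.1.1) p.1.2 - cubeAvg m D f (Φ p.2.1) p.2.2)
      (comap Prod.fst atTop ×ˢ comap Prod.fst atTop) (𝓝 0) := by
  obtain ⟨n, hn⟩ : ∃ n, D.card = n := ⟨_, rfl⟩
  induction n generalizing D X m f with
  | zero =>
    obtain rfl := Finset.card_eq_zero.1 hn
    have hne : ∀ N, (box ι (Φ N)).Nonempty := fun N => Fintype.piFinset_nonempty.2 fun _ => hΦ.1 N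
    simp [cubeAvg, Finset.expect_const (hne _)]
  | succ n ih =>
    obtain ⟨s, hs⟩ := Finset.exists_maximal (Finset.card_pos.1 (show 0 < D.card by omega))
    rcases s.eq_empty_or_nonempty with rfl | hs0
    · have hne : ∀ N, (box ι (Φ N)).Nonempty := fun N =>
        Fintype.piFinset_nonempty.2 fun _ => hΦ.1 N
      obtain rfl : D = {∅} := Finset.eq_singleton_iff_unique_mem.2
        ⟨hs.1, fun t ht => Finset.subset_empty.1 (hs.2 ht (Finset.empty_subset t))⟩
      simp [cubeAvg, Finset.expect_const (hne _)]
    obtain ⟨l, U, hl, hright, hlim⟩ := exists_right_invariant_mean (ι := ι) hΦ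
    have hmax : ∀ t ∈ D.erase s, ∃ i ∈ s, i ∉ t := fun t ht => by
      by_contra! h
      exact Finset.ne_of_mem_erase ht
        ((hs.2 (Finset.mem_of_mem_erase ht) h).antisymm h)
    have hlow : IsLowerSet (D.erase s : Set (Finset ι)) := fun t r hrt ht => by
      simp only [Finset.coe_erase, Set.mem_sdiff, Finset.mem_coe, Set.mem_singleton_iff] at ht ⊢
      refine ⟨hD hrt ht.1, ?_⟩
      rintro rfl
      exact ht.2 ((hs.2 ht.1 hrt).antisymm hrt)
    simp only [← map_mul_corrFun_self hinv hs.1 hf]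
    refine tendsto_sub_of_dual (D := fun p : ℕ × (ι → G) => corrFun D s f (Φ p.1) p.2) hm
      (fun p => abs_corrFun_le hf _ _) (k := 2 ^ s.card)
      (Nat.even_pow.2 ⟨even_two, hs0.card_pos.ne'⟩) (fun q hq => ⟨dualMap m l s q,
        fun u C hu => dualMap_sq_le hm hl s hq hu, fun η hη => ?_, ?_⟩) (hf s)
    · rw [eventually_comap]
      filter_upwards [eventually_pow_le_dualMap hΦ hm hinv hlim hs0 hmax hf hq hη] with N hN
      rintro ⟨_, y⟩ rfl
      rw [map_mul_corrFun hinv hf hq]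
      exact hN y
    · simp only [dualMap_corrFun hinv hm hright hD hs.1 hf hq]
      refine ih hlow (isMean_fiberMean hm hl) (isInvariant_fiberMean hinv) (fun t p => ?_)
        (by rw [Finset.card_erase_of_mem hs.1, hn, Nat.add_sub_cancel])
      split_ifs
      · exact abs_mul_le_one (hf _ _) (hq _)
      · simpa using hf t p.2

theorem boxNorm_univ_eq (hinv : IsInvariant (ι → G) m) {f : X → ℝ} (hf : ∀ x, |f x| ≤ 1)
    (W : Finset G) : boxNorm m W (Finset.univ : Finset ι) f =
      𝔼 a ∈ box ι W, cubeAvg m Finset.univ (fun _ => f) W a⁻¹ := by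
  refine Finset.expect_congr rfl fun a _ => Finset.expect_congr rfl fun a' _ => ?_
  rw [← hinv (fun x => ∏ t : Finset ι, f (restr t (a' * a⁻¹) • x)) 1 (restr Finset.univ a)
    fun x => abs_prod_le_one _ fun t _ => hf _, Finset.powerset_univ]
  simp only [smul_smul, restr_mul_restr_inv (Finset.subset_univ _)]

theorem map_prod_restr_inv (hinv : IsInvariant (ι → G) m) {f : X → ℝ} (hf : ∀ x, |f x| ≤ 1)
    (h : ι → G) : m (fun x => ∏ t, f (restr t h⁻¹ • x)) = m (fun x => ∏ t, f (restr t h • x)) := by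
  rw [← hinv _ 1 h fun x => abs_prod_le_one _ fun t _ => hf _]
  congr 1
  ext x
  refine Fintype.prod_equiv compl_involutive.toPerm _ _ fun t => ?_
  rw [smul_smul]
  congr 2
  ext i
  by_cases hi : i ∈ t <;> simp [restr, hi]

/-- Cubes with large correlation occur in every translate of some fixed finite set. -/
theorem exists_finset_forall_exists_lt {G : Type u} {ι : Type v} [DecidableEq ι] [Fintype ι]
    [Group G] [DecidableEq G] {Φ : ℕ → Finset G} (hΦ : IsLeftFolner Φ)
    {X : Type max u v} [MulAction (ι → G) X] {m : (X → ℝ) →ₗ[ℝ] ℝ} (hm : IsMean m)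
    (hinv : IsInvariant (ι → G) m) {f : X → ℝ} (hf : ∀ x, |f x| ≤ 1) {c : ℝ} (hc : 0 < c) :
    ∃ B : Finset (ι → G), ∀ y, ∃ h ∈ B,
      m f ^ 2 ^ Fintype.card ι - c < m (fun x => ∏ t, f (restr t (h * y) • x)) := by
  have hlow : IsLowerSet ((Finset.univ : Finset (Finset ι)) : Set (Finset ι)) := by
    rw [Finset.coe_univ]
    exact isLowerSet_univ
  obtain ⟨T, hT, hTA⟩ := mem_prod_same_iff.1
    ((tendsto_cubeAvg_sub hΦ hlow hm hinv fun _ => hf).eventually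
      (gt_mem_nhds (show 0 < c / 3 by positivity)))
  obtain ⟨M, hM⟩ := (eventually_comap.1 hT).exists
  have hA : ∀ y z, cubeAvg m Finset.univ (fun _ => f) (Φ M) y -
      cubeAvg m Finset.univ (fun _ => f) (Φ M) z < c / 3 := fun y z =>
    @hTA ((M, y), (M, z)) ⟨hM (M, y) rfl, hM (M, z) rfl⟩
  have hne : ∀ N, (box ι (Φ N)).Nonempty := fun N => Fintype.piFinset_nonempty.2 fun _ => hΦ.1 N
  obtain ⟨N, hN⟩ := (pow_expect_le_boxNorm hΦ hm hinv M (Finset.univ : Finset ι)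
    (show 0 < c / 3 by positivity)).exists
  have h := hN 1 f (fun _ _ _ => 1) hf (fun _ _ _ => by simp) (fun _ _ _ _ _ => rfl)
  simp only [Finset.prod_const_one, mul_one, hinv f 1 _ hf, Finset.expect_const (hne N),
    Finset.card_univ] at h
  refine ⟨box ι (Φ M), fun y => ?_⟩
  have hbox : boxNorm m (Φ M) (Finset.univ : Finset ι) f ≤
      cubeAvg m Finset.univ (fun _ => f) (Φ M) y + c / 3 := by
    rw [boxNorm_univ_eq hinv hf]
    exact Finset.expect_le (hne M) fun a _ => by linarith [hA a⁻¹ y]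
  by_contra! hcon
  have := Finset.expect_le (hne M) hcon
  rw [cubeAvg] at hbox
  linarith

end Cauchy

section Density

variable {H : Type*}

theorem expect_indicator (W : Finset H) (A : Set H) [DecidablePred (· ∈ A)] :
    𝔼 x ∈ W, A.indicator (1 : H → ℝ) x = ((W.filter (· ∈ A)).card : ℝ) / W.card := by
  rw [Finset.expect_eq_sum_div_card]
  congr 1
  simp [Set.indicator_apply, Finset.sum_boole]

theorem abs_indicator_le_one (A : Set H) (x : H) : |A.indicator (1 : H → ℝ) x| ≤ 1 := by
  by_cases hx : x ∈ A <;> simp [hx]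

theorem upperDensity_eq_limsup (Ψ : ℕ → Finset H) (A : Set H) :
    upperDensity Ψ A = limsup (fun N => 𝔼 x ∈ Ψ N, A.indicator (1 : H → ℝ) x) atTop := by
  classical
  simp only [upperDensity, expect_indicator]

theorem abs_expect_indicator_le (Ψ : ℕ → Finset H) (A : Set H) (N : ℕ) :
    |𝔼 x ∈ Ψ N, A.indicator (1 : H → ℝ) x| ≤ 1 :=
  abs_expect_le _ zero_le_one fun x _ => abs_indicator_le_one A x

theorem isBoundedUnder_expect (Ψ : ℕ → Finset H) (A : Set H) (F : Filter ℕ) :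
    F.IsBoundedUnder (· ≤ ·) fun N => 𝔼 x ∈ Ψ N, A.indicator (1 : H → ℝ) x :=
  isBoundedUnder_of ⟨1, fun N => (abs_le.1 (abs_expect_indicator_le Ψ A N)).2⟩

theorem isCoboundedUnder_expect (Ψ : ℕ → Finset H) (A : Set H) (F : Filter ℕ) [F.NeBot] :
    F.IsCoboundedUnder (· ≤ ·) fun N => 𝔼 x ∈ Ψ N, A.indicator (1 : H → ℝ) x :=
  IsBoundedUnder.isCoboundedUnder_le
    (isBoundedUnder_of ⟨-1, fun N => (abs_le.1 (abs_expect_indicator_le Ψ A N)).1⟩)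

/-- The upper density of a set is attained by an invariant mean dominated by the upper density. -/
theorem exists_invariant_mean_eq_upperDensity [Group H] [DecidableEq H] {Ψ : ℕ → Finset H}
    (hΨ : IsLeftFolner Ψ) (E : Set H) :
    ∃ m : (H → ℝ) →ₗ[ℝ] ℝ, IsMean m ∧ IsInvariant H m ∧
      m (E.indicator 1) = upperDensity Ψ E ∧ ∀ A : Set H, m (A.indicator 1) ≤ upperDensity Ψ A := by
  obtain ⟨U, hU, hUE⟩ := mapClusterPt_iff_ultrafilter.1
    (MapClusterPt.limsup (isCoboundedUnder_expect Ψ E atTop) (isBoundedUnder_expect Ψ E atTop))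
  obtain ⟨m, hm, hlim⟩ := exists_mean_tendsto (fun N => expectMean (Ψ N) id)
    (fun N => isMean_expectMean (hΨ.1 N) id) U
  simp only [expectMean, LinearMap.coe_mk, AddHom.coe_mk, id] at hlim
  have hinv₁ : ∀ (f : H → ℝ) (g : H), (∀ x, |f x| ≤ 1) → m (fun x => f (g • x)) = m f := by
    intro f g hf
    refine tendsto_nhds_unique (hlim (fun x => f (g • x)) 1 fun x => hf _) ?_
    refine (hlim f 1 hf).congr_dist ?_
    rw [Metric.tendsto_nhds]
    intro η hη
    filter_upwards [hU (abs_expect_shift_le hΨ g (half_pos hη))] with N hN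
    rw [Real.dist_0_eq_abs, abs_of_nonneg dist_nonneg, dist_comm, Real.dist_eq]
    exact (hN f hf).trans_lt (half_lt_self hη)
  refine ⟨m, hm, fun f C g hf => ?_, ?_, fun A => ?_⟩
  · rcases (abs_nonneg _ |>.trans (hf 1)).eq_or_lt with rfl | hC
    · have : f = 0 := by
        ext x
        exact abs_nonpos_iff.1 (hf x)
      subst this
      rfl
    · have h := hinv₁ (C⁻¹ • f) g fun x => by
        rw [Pi.smul_apply, smul_eq_mul, abs_mul, abs_of_pos (inv_pos.2 hC)]
        exact inv_mul_le_one_of_le₀ (hf x) hC.le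
      have h2 : (fun x => (C⁻¹ • f) (g • x)) = C⁻¹ • fun x => f (g • x) := rfl
      rw [h2, map_smul, map_smul] at h
      exact (smul_right_injective ℝ (inv_ne_zero hC.ne')) h
  · rw [upperDensity_eq_limsup]
    exact tendsto_nhds_unique (hlim _ 1 (abs_indicator_le_one E)) hUE
  · rw [upperDensity_eq_limsup, ← (hlim _ 1 (abs_indicator_le_one A)).limsup_eq]
    exact limsup_le_limsup_of_le hU (isCoboundedUnder_expect Ψ A U)
      (isBoundedUnder_expect Ψ A atTop)

end Density

end CubicConfigurations

/-- If `E ⊆ G^d` has positive upper density with respect to a left Følner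
sequence `Ψ` in `G^d`, then for every `c > 0` the set of `h ∈ G^d` such that the set of cubes
`h.g = {(h₁^{-ε₁}g₁, …, h_d^{-ε_d}g_d) : ε ∈ {0,1}^d}` contained in `E` has upper density
`> d_Ψ(E)^(2^d) - c` is both left and right syndetic in `G^d`. -/
theorem cubic_configurations_syndetic
    {G : Type*} [Group G] [Countable G] [DecidableEq G] (d : ℕ)
    (hG : ∃ Φ : ℕ → Finset G, IsLeftFolner Φ)
    (E : Set (Fin d → G)) (Ψ : ℕ → Finset (Fin d → G))
    (hΨ : IsLeftFolner Ψ) (hE : 0 < upperDensity Ψ E) :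
    ∀ c > (0 : ℝ),
      LeftSyndetic {h : Fin d → G |
        upperDensity Ψ {g : Fin d → G | ∀ ε : Fin d → Bool,
            (fun i => (if ε i then (h i)⁻¹ else 1) * g i) ∈ E}
          > upperDensity Ψ E ^ (2 ^ d) - c} ∧
      RightSyndetic {h : Fin d → G |
        upperDensity Ψ {g : Fin d → G | ∀ ε : Fin d → Bool,
            (fun i => (if ε i then (h i)⁻¹ else 1) * g i) ∈ E}
          > upperDensity Ψ E ^ (2 ^ d) - c} := by
  classical
  intro c hc
  obtain ⟨Φ, hΦ⟩ := hG
  obtain ⟨m, hm, hinv, hmE, hmA⟩ :=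
    CubicConfigurations.exists_invariant_mean_eq_upperDensity hΨ E
  obtain ⟨B, hB⟩ := CubicConfigurations.exists_finset_forall_exists_lt hΦ hm hinv
    (CubicConfigurations.abs_indicator_le_one E) hc
  have hmem : ∀ h : Fin d → G, m (E.indicator 1) ^ 2 ^ Fintype.card (Fin d) - c <
      m (fun x => ∏ t, E.indicator 1 (CubicConfigurations.restr t h⁻¹ • x)) →
      h ∈ {h : Fin d → G | upperDensity Ψ {g : Fin d → G | ∀ ε : Fin d → Bool,
            (fun i => (if ε i then (h i)⁻¹ else 1) * g i) ∈ E}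
          > upperDensity Ψ E ^ (2 ^ d) - c} := by
    intro h hh
    rw [hmE, Fintype.card_fin] at hh
    refine hh.trans_le (le_of_eq_of_le (congrArg m ?_) (hmA _))
    ext g
    have hr : ∀ ε : Fin d → Bool, (fun i => (if ε i then (h i)⁻¹ else 1) * g i) =
        CubicConfigurations.restr {i | ε i} h⁻¹ • g := fun ε => by
      ext i
      simp [CubicConfigurations.restr]
    by_cases hg : ∀ t : Finset (Fin d), CubicConfigurations.restr t h⁻¹ • g ∈ E
    · rw [Set.indicator_of_mem, Finset.prod_eq_one fun t _ => Set.indicator_of_mem (hg t) _]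
      · rfl
      · intro ε
        rw [hr]
        exact hg _
    · rw [Set.indicator_of_notMem]
      · obtain ⟨t, ht⟩ := not_forall.1 hg
        exact Finset.prod_eq_zero (Finset.mem_univ t) (Set.indicator_of_notMem ht _)
      · intro hall
        refine hg fun t => ?_
        have := hall fun i => decide (i ∈ t)
        rw [hr] at this
        simpa using this
  constructor
  · refine ⟨B.image (·⁻¹), fun x => ?_⟩
    obtain ⟨h, hh, hx⟩ := hB x
    exact ⟨h⁻¹, Finset.mem_image_of_mem _ hh, by
      rw [inv_inv]
      exact hmem _ (by
        rwa [CubicConfigurations.map_prod_restr_inv hinv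
          (CubicConfigurations.abs_indicator_le_one E)])⟩
  · refine ⟨B, fun x => ?_⟩
    obtain ⟨h, hh, hx⟩ := hB x⁻¹
    exact ⟨h, hh, hmem _ (by simpa using hx)⟩
end

section
/- Let G be a countable amenable group, let (X, 𝒳, μ) be a probability space, and let T and S be commuting measure-preserving actions of G on X. Suppose f ∈ L^∞(μ) is a nonnegative function. Then for all two-sided Følner sequences Φ, Ψ in G, lim_{N→∞} (1/(|Φ_N||Ψ_N|)) Σ_{(g,h) ∈ Φ_N × Ψ_N} ∫ f · (f ∘ T_g) · (f ∘ S_h) · (f ∘ T_g S_h) dμ ≥ (∫ f dμ)⁴. -/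
open MeasureTheory Filter Topology

namespace FolnerAverage

open Finset

variable {G : Type*} [Group G]

/-- The average of `c` over the finite set `s`. -/
noncomputable def avg {ι : Type*} (s : Finset ι) (c : ι → ℝ) : ℝ := (s.card : ℝ)⁻¹ * ∑ g ∈ s, c g

section Average

variable {ι κ : Type*} {s : Finset ι}

lemma avg_const (hs : s.Nonempty) (a : ℝ) : avg s (fun _ => a) = a := by
  have : (s.card : ℝ) ≠ 0 := by exact_mod_cast hs.card_pos.ne'
  simp [avg, this]

lemma avg_mono {c d : ι → ℝ} (h : ∀ i ∈ s, c i ≤ d i) : avg s c ≤ avg s d :=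
  mul_le_mul_of_nonneg_left (sum_le_sum h) (by positivity)

lemma avg_sub (c d : ι → ℝ) : avg s (fun i => c i - d i) = avg s c - avg s d := by
  simp [avg, sum_sub_distrib, mul_sub]

lemma avg_const_mul (a : ℝ) (c : ι → ℝ) : avg s (fun i => a * c i) = a * avg s c := by
  simp only [avg, ← mul_sum]; ring

lemma avg_sum (r : Finset κ) (c : κ → ι → ℝ) :
    avg s (fun i => ∑ k ∈ r, c k i) = ∑ k ∈ r, avg s (c k) := by
  simp only [avg, ← mul_sum]
  rw [sum_comm]

lemma abs_avg_le (hs : s.Nonempty) {c : ι → ℝ} {C : ℝ} (h : ∀ i ∈ s, |c i| ≤ C) :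
    |avg s c| ≤ C := by
  refine abs_le.2 ⟨?_, ?_⟩
  · rw [← avg_const hs (-C)]
    exact avg_mono fun i hi => (abs_le.1 (h i hi)).1
  · rw [← avg_const hs C]
    exact avg_mono fun i hi => (abs_le.1 (h i hi)).2

lemma sq_avg_le_avg_sq (hs : s.Nonempty) (c : ι → ℝ) : avg s c ^ 2 ≤ avg s (fun i => c i ^ 2) := by
  have h : avg s (fun i => 2 * avg s c * c i - avg s c ^ 2) ≤ avg s (fun i => c i ^ 2) :=
    avg_mono fun i _ => by nlinarith [sq_nonneg (c i - avg s c)]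
  rw [avg_sub, avg_const_mul, avg_const hs] at h
  linarith

end Average

lemma abs_sum_translate_sub_sum_le [DecidableEq G] (s : Finset G) (k : G) {c : G → ℝ} {C : ℝ}
    (hc : ∀ g, |c g| ≤ C) :
    |∑ g ∈ s, c (k * g) - ∑ g ∈ s, c g| ≤
      2 * C * (s.card - ((s ∩ s.image (fun x => k * x)).card : ℝ)) := by
  set r := s.image (fun x => k * x) with hr
  have hinj : Function.Injective (fun x : G => k * x) := mul_right_injective k
  have hcard : r.card = s.card := card_image_of_injective _ hinj
  have hsum : ∑ g ∈ s, c (k * g) = ∑ g ∈ r, c g := (sum_image hinj.injOn).symm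
  have h1 : ∑ g ∈ r, c g = ∑ g ∈ s ∩ r, c g + ∑ g ∈ r \ s, c g := by
    rw [← sum_inter_add_sum_sdiff r s, inter_comm]
  have h2 : ∑ g ∈ s, c g = ∑ g ∈ s ∩ r, c g + ∑ g ∈ s \ r, c g :=
    (sum_inter_add_sum_sdiff s r c).symm
  have bound (u : Finset G) : |∑ g ∈ u, c g| ≤ u.card * C := by
    refine (abs_sum_le_sum_abs _ _).trans ((sum_le_sum fun g _ => hc g).trans ?_)
    simp
  have c1 : ((r \ s).card : ℝ) = s.card - (s ∩ r).card := by
    have := card_inter_add_card_sdiff r s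
    rw [inter_comm, hcard] at this
    rw [← this]; push_cast; ring
  have c2 : ((s \ r).card : ℝ) = s.card - (s ∩ r).card := by
    rw [← card_inter_add_card_sdiff s r]; push_cast; ring
  rw [hsum, h1, h2, add_sub_add_left_eq_sub]
  have b1 := bound (r \ s)
  have b2 := bound (s \ r)
  rw [c1] at b1
  rw [c2] at b2
  linarith [abs_sub (∑ g ∈ r \ s, c g) (∑ g ∈ s \ r, c g)]

lemma tendsto_avg_translate_sub [DecidableEq G] {Φ : ℕ → Finset G} (hΦ : IsLeftFolner Φ)
    {c : ℕ → G → ℝ} {C : ℝ} (hc : ∀ N g, |c N g| ≤ C) (k : G) :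
    Tendsto (fun N => avg (Φ N) (fun g => c N (k * g)) - avg (Φ N) (c N)) atTop (𝓝 0) := by
  have hlim := ((hΦ.2 k).const_sub 1).const_mul (2 * C)
  rw [sub_self, mul_zero] at hlim
  refine squeeze_zero_norm (fun N => ?_) hlim
  have hpos : (0 : ℝ) < (Φ N).card := by exact_mod_cast (hΦ.1 N).card_pos
  rw [Real.norm_eq_abs, avg, avg, ← mul_sub, abs_mul, abs_of_pos (inv_pos.2 hpos)]
  refine (mul_le_mul_of_nonneg_left (abs_sum_translate_sub_sum_le (Φ N) k (hc N))
    (inv_pos.2 hpos).le).trans_eq ?_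
  field_simp

/-- The bilinear form on finitely supported functions with kernel `φ (g⁻¹ * h)`. -/
noncomputable def form (φ : G → ℝ) : (G →₀ ℝ) →ₗ[ℝ] (G →₀ ℝ) →ₗ[ℝ] ℝ :=
  Finsupp.linearCombination ℝ fun g => Finsupp.linearCombination ℝ fun h => φ (g⁻¹ * h)

/-- The sum of the values of a finitely supported function. -/
noncomputable def total {ι : Type*} : (ι →₀ ℝ) →ₗ[ℝ] ℝ :=
  Finsupp.linearCombination ℝ fun _ => (1 : ℝ)

lemma form_apply (φ : G → ℝ) (p q : G →₀ ℝ) :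
    form φ p q = ∑ g ∈ p.support, ∑ h ∈ q.support, p g * q h * φ (g⁻¹ * h) := by
  simp [form, Finsupp.linearCombination_apply, Finsupp.sum, LinearMap.sum_apply, mul_sum, mul_assoc]

lemma total_apply {ι : Type*} (p : ι →₀ ℝ) : total p = ∑ g ∈ p.support, p g := by
  simp [total, Finsupp.linearCombination_apply, Finsupp.sum]

lemma form_single_left (φ : G → ℝ) (g : G) (p : G →₀ ℝ) :
    form φ (Finsupp.single g 1) p = ∑ h ∈ p.support, p h * φ (g⁻¹ * h) := by
  simp [form, Finsupp.linearCombination_apply, Finsupp.sum]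

/-- A real positive definite function on a group. -/
structure IsPosDef (φ : G → ℝ) : Prop where
  symm : ∀ g, φ g⁻¹ = φ g
  nonneg : ∀ p, 0 ≤ form φ p p

lemma form_comm {φ : G → ℝ} (hφ : ∀ g, φ g⁻¹ = φ g) (p q : G →₀ ℝ) :
    form φ p q = form φ q p := by
  rw [form_apply, form_apply, sum_comm]
  refine sum_congr rfl fun g _ => sum_congr rfl fun h _ => ?_
  rw [← hφ, mul_inv_rev, inv_inv]; ring

lemma tendsto_form {φ : ℕ → G → ℝ} {ψ : G → ℝ} (h : ∀ g, Tendsto (φ · g) atTop (𝓝 (ψ g)))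
    (p q : G →₀ ℝ) : Tendsto (fun N => form (φ N) p q) atTop (𝓝 (form ψ p q)) := by
  simp only [form_apply]
  exact tendsto_finsetSum _ fun g _ => tendsto_finsetSum _ fun k _ => (h _).const_mul _

lemma form_avg {ι : Type*} (s : Finset ι) (φ : ι → G → ℝ) (p q : G →₀ ℝ) :
    form (fun g => avg s (φ · g)) p q = avg s (fun i => form (φ i) p q) := by
  simp only [form_apply, avg_sum, avg_const_mul]

lemma IsPosDef.avg {ι : Type*} {s : Finset ι} (hs : s.Nonempty) {φ : ι → G → ℝ}
    (hφ : ∀ i, IsPosDef (φ i)) : IsPosDef (fun g => avg s (φ · g)) where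
  symm g := by simp only [(hφ _).symm]
  nonneg p := by
    rw [form_avg, ← avg_const hs 0]
    exact avg_mono fun i _ => (hφ i).nonneg p

lemma IsPosDef.of_tendsto {φ : ℕ → G → ℝ} {ψ : G → ℝ} (hφ : ∀ N, IsPosDef (φ N))
    (h : ∀ g, Tendsto (φ · g) atTop (𝓝 (ψ g))) : IsPosDef ψ where
  symm g := tendsto_nhds_unique (h g⁻¹) (by simpa only [(hφ _).symm] using h g)
  nonneg p := ge_of_tendsto' (tendsto_form h p p) fun N => (hφ N).nonneg p

/-- The infimum of the quadratic form of `φ` over the finitely supported functions of total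
mass one. -/
noncomputable def minVal (φ : G → ℝ) : ℝ := ⨅ p : {p : G →₀ ℝ // total p = 1}, form φ p.1 p.1

instance : Nonempty {p : G →₀ ℝ // total p = 1} := ⟨Finsupp.single 1 1, by simp [total]⟩

lemma le_minVal {φ : G → ℝ} {a : ℝ} (h : ∀ p, total p = 1 → a ≤ form φ p p) : a ≤ minVal φ :=
  le_ciInf fun p => h p.1 p.2

lemma exists_form_lt_minVal_add (φ : G → ℝ) {ε : ℝ} (hε : 0 < ε) : ∃ p, total p = 1 ∧ form φ p p < minVal φ + ε := by
  obtain ⟨p, hp⟩ := exists_lt_of_ciInf_lt (lt_add_of_pos_right (minVal φ) hε)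
  exact ⟨p.1, p.2, hp⟩

namespace IsPosDef

variable {φ : G → ℝ} (hφ : IsPosDef φ)

include hφ

lemma minVal_nonneg : 0 ≤ minVal φ := le_minVal fun p _ => hφ.nonneg p

lemma minVal_le {p : G →₀ ℝ} (hp : total p = 1) : minVal φ ≤ form φ p p :=
  ciInf_le (f := fun p : {p : G →₀ ℝ // total p = 1} => form φ p.1 p.1)
    ⟨0, by rintro _ ⟨q, rfl⟩; exact hφ.nonneg _⟩ ⟨p, hp⟩

lemma minVal_mul_sq_le (p : G →₀ ℝ) : minVal φ * total p ^ 2 ≤ form φ p p := by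
  by_cases h : total p = 0
  · simpa [h] using hφ.nonneg p
  · have := hφ.minVal_le (p := (total p)⁻¹ • p) (by simp [h])
    simp only [map_smul, LinearMap.smul_apply, smul_eq_mul] at this
    calc _ ≤ (total p)⁻¹ * ((total p)⁻¹ * form φ p p) * total p ^ 2 := by gcongr
      _ = form φ p p := by field_simp

lemma abs_form_single_sub_le {L : ℝ} (hL : ∀ p, L * total p ^ 2 ≤ form φ p p) (g : G)
    {p : G →₀ ℝ} (hp : total p = 1) {t : ℝ} (ht : 0 < t) :
    |form φ (Finsupp.single g 1) p - L| ≤ t * (φ 1 - L) + (form φ p p - L) / t := by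
  have h1 := hL (t • Finsupp.single g 1 + p)
  have h2 := hL (t • Finsupp.single g 1 - p)
  have h0 := hL (Finsupp.single g 1)
  have h3 := hL p
  have hsing : total (Finsupp.single g (1 : ℝ)) = 1 := by simp [total]
  have hdiag : form φ (Finsupp.single g 1) (Finsupp.single g 1) = φ 1 := by simp [form]
  simp only [map_add, map_sub, map_smul, LinearMap.add_apply, LinearMap.sub_apply,
    LinearMap.smul_apply, smul_eq_mul, hp, hsing, hdiag, form_comm hφ.symm p] at h0 h1 h2 h3
  set X := form φ (Finsupp.single g 1) p
  set Y := form φ p p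
  have key : ∀ Z, 2 * t * Z ≤ t ^ 2 * (φ 1 - L) + (Y - L) → Z ≤ t * (φ 1 - L) + (Y - L) / t := by
    intro Z hZ
    have : 0 ≤ t * (φ 1 - L) + (Y - L) / t := by
      have := div_nonneg (show 0 ≤ Y - L by linarith) ht.le
      nlinarith
    by_contra! hlt
    have h4 : t * (t * (φ 1 - L) + (Y - L) / t) < t * Z := mul_lt_mul_of_pos_left hlt ht
    have h5 : t * (t * (φ 1 - L) + (Y - L) / t) = t ^ 2 * (φ 1 - L) + (Y - L) := by
      field_simp
    nlinarith
  exact abs_le'.2 ⟨key _ (by nlinarith), key _ (by nlinarith)⟩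

end IsPosDef

lemma tendsto_avg_of_tendsto [DecidableEq G] {Φ : ℕ → Finset G} (hΦ : IsLeftFolner Φ)
    {φ : ℕ → G → ℝ} {ψ : G → ℝ} {C : ℝ} {L : ℕ → ℝ}
    (hφ : ∀ N, IsPosDef (φ N)) (hC : ∀ N g, |φ N g| ≤ C)
    (hψ : ∀ g, Tendsto (φ · g) atTop (𝓝 (ψ g)))
    (hL0 : ∀ N, 0 ≤ L N) (hL : ∀ N p, L N * total p ^ 2 ≤ form (φ N) p p)
    (hLlim : Tendsto L atTop (𝓝 (minVal ψ))) :
    Tendsto (fun N => avg (Φ N) (φ N)) atTop (𝓝 (minVal ψ)) := by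
  have hC0 : 0 ≤ C := (abs_nonneg _).trans (hC 0 1)
  rw [Metric.tendsto_atTop']
  intro ε hε
  set δ := ε / 6 with hδ
  have hδ0 : 0 < δ := by positivity
  set t := δ / (C + 1)
  have ht : 0 < t := by positivity
  obtain ⟨p, hp, hpψ⟩ := exists_form_lt_minVal_add ψ (mul_pos hδ0 ht)
  have hform := (tendsto_form hψ p p).sub hLlim
  have hform' : ∀ᶠ N in atTop, form (φ N) p p - L N < δ * t :=
    hform.eventually_lt_const (by linarith)
  have htrans : Tendsto (fun N => ∑ k ∈ p.support, p k *
      (avg (Φ N) (fun g => φ N (k⁻¹ * g)) - avg (Φ N) (φ N))) atTop (𝓝 0) := by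
    have := tendsto_finsetSum p.support fun k _ =>
      (tendsto_avg_translate_sub hΦ hC k⁻¹).const_mul (p k)
    simpa using this
  have hshift (N : ℕ) : ∑ k ∈ p.support, p k *
      (avg (Φ N) (fun g => φ N (k⁻¹ * g)) - avg (Φ N) (φ N)) =
      avg (Φ N) (fun g => form (φ N) (Finsupp.single g 1) p) - avg (Φ N) (φ N) := by
    simp only [mul_sub, sum_sub_distrib, ← sum_mul, ← total_apply, hp, one_mul, form_single_left,
      avg_sum, avg_const_mul]
    congr 1
    refine sum_congr rfl fun k _ => ?_
    congr 2
    funext g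
    rw [← (hφ N).symm, mul_inv_rev, inv_inv]
  obtain ⟨M, hM⟩ := eventually_atTop.1 ((hform'.and
    ((Metric.tendsto_nhds.1 htrans) δ hδ0)).and ((Metric.tendsto_nhds.1 hLlim) δ hδ0))
  refine ⟨M, fun N hN => ?_⟩
  obtain ⟨⟨h1, h2⟩, h3⟩ := hM N hN.le
  rw [hshift, Real.dist_eq, sub_zero] at h2
  rw [Real.dist_eq] at h3 ⊢
  have h4 : |avg (Φ N) (fun g => form (φ N) (Finsupp.single g 1) p) - L N| ≤ 2 * δ := by
    rw [← avg_const (hΦ.1 N) (L N), ← avg_sub]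
    refine abs_avg_le (hΦ.1 N) fun g _ => ?_
    refine ((hφ N).abs_form_single_sub_le (hL N) g hp ht).trans ?_
    have e1 : t * (φ N 1 - L N) ≤ δ := by
      calc t * (φ N 1 - L N) ≤ t * (C + 1) := by
            gcongr; linarith [(abs_le.1 (hC N 1)).2, hL0 N]
        _ = δ := by simp only [t]; field_simp
    have e2 : (form (φ N) p p - L N) / t ≤ δ := by
      rw [div_le_iff₀ ht]; exact h1.le
    linarith
  rw [abs_lt] at h2 h3 ⊢
  rw [abs_le] at h4
  constructor <;> linarith [h4.1, h4.2, h2.1, h2.2, h3.1, h3.2]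

lemma IsPosDef.tendsto_avg [DecidableEq G] {Φ : ℕ → Finset G} (hΦ : IsLeftFolner Φ)
    {φ : G → ℝ} {C : ℝ} (hφ : IsPosDef φ) (hC : ∀ g, |φ g| ≤ C) :
    Tendsto (fun N => FolnerAverage.avg (Φ N) φ) atTop (𝓝 (minVal φ)) :=
  tendsto_avg_of_tendsto hΦ (fun _ => hφ) (fun _ => hC) (fun _ => tendsto_const_nhds)
    (fun _ => hφ.minVal_nonneg) (fun _ => hφ.minVal_mul_sq_le) tendsto_const_nhds

section TwoVariables

variable [DecidableEq G] {Φ Ψ : ℕ → Finset G} {b : G → G → ℝ} {C : ℝ}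
  (hΨ : IsLeftFolner Ψ) (hb₁ : ∀ h, IsPosDef (b · h)) (hb₂ : ∀ g, IsPosDef (b g))
  (hC : ∀ g h, |b g h| ≤ C)

include hΨ hb₁ hb₂ hC

lemma isPosDef_minVal : IsPosDef (fun g => minVal (b g)) :=
  IsPosDef.of_tendsto (fun N => IsPosDef.avg (hΨ.1 N) hb₁) fun g => (hb₂ g).tendsto_avg hΨ (hC g)

omit hb₁ in
lemma abs_minVal_le (g : G) : |minVal (b g)| ≤ C :=
  le_of_tendsto' ((hb₂ g).tendsto_avg hΨ (hC g)).abs fun N => abs_avg_le (hΨ.1 N) fun h _ => hC g h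

lemma tendsto_avg_minVal (hΦ : IsLeftFolner Φ) :
    Tendsto (fun N => avg (Φ N) (fun g => minVal (b g))) atTop
      (𝓝 (minVal fun g => minVal (b g))) :=
  (isPosDef_minVal hΨ hb₁ hb₂ hC).tendsto_avg hΦ (abs_minVal_le hΨ hb₂ hC)

omit [DecidableEq G] hΨ hb₁ hC in
lemma avg_minVal_mul_sq_le {s : Finset G} (p : G →₀ ℝ) :
    avg s (fun g => minVal (b g)) * total p ^ 2 ≤ form (fun h => avg s (b · h)) p p := by
  rw [form_avg, mul_comm, ← avg_const_mul]
  exact avg_mono fun g _ => by rw [mul_comm]; exact (hb₂ g).minVal_mul_sq_le p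

lemma minVal_minVal_le (hΦ : IsLeftFolner Φ) :
    minVal (fun g => minVal (b g)) ≤ minVal (fun h => minVal (b · h)) := by
  refine le_minVal fun p hp => ?_
  refine le_of_tendsto_of_tendsto' (tendsto_avg_minVal hΨ hb₁ hb₂ hC hΦ)
    (tendsto_form (fun h => (hb₁ h).tendsto_avg hΦ fun g => hC g h) p p) fun N => ?_
  simpa [hp] using avg_minVal_mul_sq_le hb₂ (s := Φ N) p

lemma tendsto_avg_avg (hΦ : IsLeftFolner Φ) :
    Tendsto (fun N => avg (Ψ N) (fun h => avg (Φ N) (b · h))) atTop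
      (𝓝 (minVal fun g => minVal (b g))) := by
  have heq : minVal (fun g => minVal (b g)) = minVal (fun h => minVal (b · h)) :=
    (minVal_minVal_le hΨ hb₁ hb₂ hC hΦ).antisymm
      (minVal_minVal_le (b := fun h g => b g h) hΦ hb₂ hb₁ (fun h g => hC g h) hΨ)
  have hlim := tendsto_avg_minVal hΨ hb₁ hb₂ hC hΦ
  rw [heq] at hlim ⊢
  refine tendsto_avg_of_tendsto hΨ (fun N => IsPosDef.avg (hΦ.1 N) hb₂)
    (fun N h => abs_avg_le (hΦ.1 N) fun g _ => hC g h)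
    (fun h => (hb₁ h).tendsto_avg hΦ fun g => hC g h) (fun N => ?_)
    (fun N => avg_minVal_mul_sq_le hb₂) hlim
  rw [← avg_const (hΦ.1 N) 0]
  exact avg_mono fun g _ => (hb₂ g).minVal_nonneg

end TwoVariables

section Correlation

variable {X : Type*} [MeasurableSpace X] {μ : Measure X} [IsProbabilityMeasure μ]
  {R : G → X → X} {u : X → ℝ}

variable (hmp : ∀ g, MeasurePreserving (R g) μ μ) (hhom : ∀ g h, R (g * h) = R g ∘ R h)
  (hu : Measurable u) (hbdd : ∃ C, ∀ x, |u x| ≤ C)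

include hmp hhom hu hbdd

lemma form_correlation (p q : G →₀ ℝ) :
    form (fun g => ∫ x, u x * u (R g x) ∂μ) p q =
      ∫ x, (∑ g ∈ p.support, p g * u (R g⁻¹ x)) * (∑ h ∈ q.support, q h * u (R h⁻¹ x)) ∂μ := by
  obtain ⟨C, hC⟩ := hbdd
  have hmeas (g : G) : Measurable fun x => u (R g x) := hu.comp (hmp g).measurable
  have hint (g h : G) : Integrable (fun x => p g * q h * (u (R g⁻¹ x) * u (R h⁻¹ x))) μ := by
    refine (Integrable.of_bound ((hmeas _).mul (hmeas _)).aestronglyMeasurable (C * C)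
      (.of_forall fun x => ?_)).const_mul _
    rw [Pi.mul_apply, norm_mul]
    exact mul_le_mul (hC _) (hC _) (norm_nonneg _) ((abs_nonneg _).trans (hC x))
  have hshift (g h : G) :
      ∫ x, u x * u (R (g⁻¹ * h) x) ∂μ = ∫ x, u (R g⁻¹ x) * u (R h⁻¹ x) ∂μ := by
    have hm : AEStronglyMeasurable (fun x => u x * u (R (g⁻¹ * h) x)) (μ.map (R h⁻¹)) :=
      (hu.mul (hmeas _)).aestronglyMeasurable
    conv_lhs => rw [← (hmp h⁻¹).map_eq]
    rw [integral_map (hmp h⁻¹).aemeasurable hm]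
    congr with x
    rw [show R (g⁻¹ * h) (R h⁻¹ x) = R g⁻¹ x by
      rw [← Function.comp_apply (f := R (g⁻¹ * h)), ← hhom, mul_inv_cancel_right], mul_comm]
  rw [form_apply]
  simp only [hshift, ← integral_const_mul]
  rw [sum_congr rfl fun g _ => (integral_finsetSum _ fun h _ => hint g h).symm,
    ← integral_finsetSum _ fun g _ => integrable_finsetSum _ fun h _ => hint g h]
  congr with x
  rw [sum_mul_sum]
  exact sum_congr rfl fun g _ => sum_congr rfl fun h _ => by ring

lemma isPosDef_correlation : IsPosDef (fun g => ∫ x, u x * u (R g x) ∂μ) where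
  symm g := by
    have h1 := form_correlation hmp hhom hu hbdd (Finsupp.single g 1) (Finsupp.single 1 1)
    have h2 := form_correlation hmp hhom hu hbdd (Finsupp.single 1 1) (Finsupp.single g 1)
    simp only [mul_comm (∑ h ∈ (Finsupp.single g (1 : ℝ)).support, _ * _)] at h1
    rw [← h2] at h1
    simpa [form] using h1
  nonneg p := by
    rw [form_correlation hmp hhom hu hbdd]
    exact integral_nonneg fun x => mul_self_nonneg _

lemma sq_integral_le_minVal_correlation :
    (∫ x, u x ∂μ) ^ 2 ≤ minVal (fun g => ∫ x, u x * u (R g x) ∂μ) := by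
  refine le_minVal fun p hp => ?_
  rw [form_correlation hmp hhom hu hbdd]
  obtain ⟨C, hC⟩ := hbdd
  have hmeas (g : G) : Measurable fun x => u (R g x) := hu.comp (hmp g).measurable
  set v : X → ℝ := fun x => ∑ g ∈ p.support, p g * u (R g⁻¹ x)
  have hv : Measurable v := Finset.measurable_sum _ fun g _ => (hmeas _).const_mul _
  have hint (g : G) : Integrable (fun x => p g * u (R g⁻¹ x)) μ :=
    (Integrable.of_bound (hmeas _).aestronglyMeasurable C (.of_forall fun x => hC _)).const_mul _
  have hvi : Integrable v μ := integrable_finsetSum _ fun g _ => hint g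
  have hvint : ∫ x, v x ∂μ = ∫ x, u x ∂μ := by
    have hinv (g : G) : ∫ x, u (R g x) ∂μ = ∫ x, u x ∂μ := by
      conv_rhs => rw [← (hmp g).map_eq]
      rw [integral_map (hmp g).aemeasurable hu.aestronglyMeasurable]
    rw [integral_finsetSum _ fun g _ => hint g]
    simp only [integral_const_mul, hinv, ← sum_mul, ← total_apply, hp, one_mul]
  have hvb (x : X) : |v x| ≤ ∑ g ∈ p.support, |p g| * C := by
    refine (abs_sum_le_sum_abs _ _).trans (sum_le_sum fun g _ => ?_)
    rw [abs_mul]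
    exact mul_le_mul_of_nonneg_left (hC _) (abs_nonneg _)
  have hv2 : Integrable (fun x => v x * v x) μ :=
    hvi.mul_bdd hv.aestronglyMeasurable (.of_forall hvb)
  rw [← hvint]
  set a := ∫ x, v x ∂μ with ha
  have h : ∫ x, (2 * a * v x - a ^ 2) ∂μ ≤ ∫ x, v x * v x ∂μ :=
    integral_mono ((hvi.const_mul _).sub (integrable_const _)) hv2 fun x => by
      dsimp only
      nlinarith [sq_nonneg (v x - a)]
  rw [integral_sub (hvi.const_mul _) (integrable_const _), integral_const_mul, ← ha] at h
  simp only [integral_const, probReal_univ, one_smul] at h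
  linarith

end Correlation

end FolnerAverage

open FolnerAverage
/-- For nonnegative bounded measurable `f` and commuting actions `T, S`,
the limit of `(1/(|Φ_N||Ψ_N|)) Σ_{(g,h)} ∫ f ⋅ (f∘T_g) ⋅ (f∘S_h) ⋅ (f∘T_g S_h) dμ` exists
and is at least `(∫ f dμ)⁴`. -/
theorem khintchine_two_actions_bound
    {G X : Type*} [Group G] [Countable G] [DecidableEq G]
    [MeasurableSpace X] (μ : Measure X) [IsProbabilityMeasure μ]
    (T S : G → X → X)
    (hT_mp : ∀ g, MeasurePreserving (T g) μ μ)
    (hS_mp : ∀ g, MeasurePreserving (S g) μ μ)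
    (hT_bij : ∀ g, Function.Bijective (T g))
    (hS_bij : ∀ g, Function.Bijective (S g))
    (hT_hom : ∀ g h, T (g * h) = T g ∘ T h)
    (hS_hom : ∀ g h, S (g * h) = S g ∘ S h)
    (hTS_comm : ∀ g h, T g ∘ S h = S h ∘ T g)
    (f : X → ℝ) (hf_meas : Measurable f) (hf_bdd : ∃ C, ∀ x, |f x| ≤ C)
    (hf_nonneg : ∀ x, 0 ≤ f x)
    (Φ Ψ : ℕ → Finset G) (hΦ : IsTwoSidedFolner Φ) (hΨ : IsTwoSidedFolner Ψ) :
    ∃ l : ℝ,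
      Tendsto (fun N =>
        (((Φ N).card : ℝ) * ((Ψ N).card : ℝ))⁻¹ *
          ∑ g ∈ Φ N, ∑ h ∈ Ψ N,
            ∫ x, f x * f (T g x) * f (S h x) * f (T g (S h x)) ∂μ)
        atTop (𝓝 l) ∧ (∫ x, f x ∂μ) ^ 4 ≤ l := by
  obtain ⟨C, hC⟩ := hf_bdd
  set b : G → G → ℝ := fun g h => ∫ x, f x * f (T g x) * f (S h x) * f (T g (S h x)) ∂μ with hb
  have hCmul {v w : X → ℝ} {A B : ℝ} (hv : ∀ x, |v x| ≤ A) (hw : ∀ x, |w x| ≤ B) (x : X) :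
      |v x * w x| ≤ A * B := by
    rw [abs_mul]
    exact mul_le_mul (hv x) (hw x) (abs_nonneg _) ((abs_nonneg _).trans (hv x))
  have hTm (g : G) : Measurable (T g) := (hT_mp g).measurable
  have hSm (g : G) : Measurable (S g) := (hS_mp g).measurable
  have hmeasT (g : G) : Measurable fun x => f x * f (T g x) := hf_meas.mul (hf_meas.comp (hTm g))
  have hmeasS (g : G) : Measurable fun x => f x * f (S g x) := hf_meas.mul (hf_meas.comp (hSm g))
  have hbddT (g : G) : ∀ x, |f x * f (T g x)| ≤ C * C := hCmul hC fun x => hC _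
  have hbddS (g : G) : ∀ x, |f x * f (S g x)| ≤ C * C := hCmul hC fun x => hC _
  have hb_S (g : G) :
      b g = fun h => ∫ x, (f x * f (T g x)) * (f (S h x) * f (T g (S h x))) ∂μ := by
    funext h
    simp only [hb, mul_assoc]
  have hb_T (h : G) :
      (b · h) = fun g => ∫ x, (f x * f (S h x)) * (f (T g x) * f (S h (T g x))) ∂μ := by
    funext g
    simp only [hb]
    congr with x
    rw [show T g (S h x) = S h (T g x) from congrFun (hTS_comm g h) x]
    ring
  have hb₂ (g : G) : IsPosDef (b g) := by
    rw [hb_S]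
    exact isPosDef_correlation hS_mp hS_hom (hmeasT g) ⟨_, hbddT g⟩
  have hb₁ (h : G) : IsPosDef (b · h) := by
    rw [hb_T]
    exact isPosDef_correlation hT_mp hT_hom (hmeasS h) ⟨_, hbddS h⟩
  have hbC (g h : G) : |b g h| ≤ C * C * (C * C) := by
    rw [hb_S, ← Real.norm_eq_abs]
    refine (norm_integral_le_of_norm_le_const
      (.of_forall (hCmul (hbddT g) fun x => hbddT g _))).trans_eq ?_
    simp
  refine ⟨minVal fun g => minVal (b g), ?_, ?_⟩
  · convert tendsto_avg_avg hΨ.1 hb₁ hb₂ hbC hΦ.1 using 2 with N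
    simp only [avg, ← Finset.mul_sum]
    rw [Finset.sum_comm, mul_inv]
    ring
  · have hr := isPosDef_correlation hT_mp hT_hom hf_meas ⟨C, hC⟩
    have hrC (g : G) : |∫ x, f x * f (T g x) ∂μ| ≤ C * C := by
      rw [← Real.norm_eq_abs]
      refine (norm_integral_le_of_norm_le_const (.of_forall (hbddT g))).trans_eq ?_
      simp
    have hmin := sq_integral_le_minVal_correlation hT_mp hT_hom hf_meas ⟨C, hC⟩
    calc (∫ x, f x ∂μ) ^ 4 = ((∫ x, f x ∂μ) ^ 2) ^ 2 := by ring
      _ ≤ minVal (fun g => ∫ x, f x * f (T g x) ∂μ) ^ 2 := by gcongr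
      _ ≤ _ := le_of_tendsto_of_tendsto' ((hr.tendsto_avg hΦ.1 hrC).pow 2)
        (tendsto_avg_minVal hΨ.1 hb₁ hb₂ hbC hΦ.1) fun N => ?_
    refine (sq_avg_le_avg_sq (hΦ.1.1 N) _).trans (avg_mono fun g _ => ?_)
    rw [hb_S]
    exact sq_integral_le_minVal_correlation hS_mp hS_hom (hmeasT g) ⟨_, hbddT g⟩
end

section
/- Let G be a countable amenable group with identity e, let E ⊆ G × G, and let Φ be a right Følner sequence in G × G with limsup_{N→∞} |E ∩ Φ_N|/|Φ_N| = δ > 0. For (a,b) ∈ G × G write E(a,b) = {(xa, yb) : (x,y) ∈ E}. Then for all c > 0, the set {(g,h) ∈ G × G : limsup_{N→∞} |E ∩ E(g⁻¹, e) ∩ E(e, h⁻¹) ∩ E(g⁻¹, h⁻¹) ∩ Φ_N| / |Φ_N| > δ⁴ − c} is both left syndetic and right syndetic in G × G. -/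
open MeasureTheory Filter Topology

/-- `E(a,b) = {(xa, yb) : (x,y) ∈ E}`. -/
def rightShift {G : Type*} [Group G] (E : Set (G × G)) (a b : G) : Set (G × G) :=
  (fun q : G × G => (q.1 * a, q.2 * b)) '' E

universe u

lemma abs_mul_le_one {a b : ℝ} (ha : |a| ≤ 1) (hb : |b| ≤ 1) : |a * b| ≤ 1 := by
  rw [abs_mul]
  exact mul_le_one₀ ha (abs_nonneg _) hb

/-- A real function is bounded if its absolute value has a uniform bound. -/
def Bdd {α : Type*} (f : α → ℝ) : Prop := ∃ C, ∀ x, |f x| ≤ C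

namespace Bdd

variable {α β : Type*} {f g : α → ℝ}

lemma const (c : ℝ) : Bdd (fun _ : α => c) := ⟨|c|, fun _ => le_rfl⟩

lemma comp (hf : Bdd f) (e : β → α) : Bdd (fun x => f (e x)) :=
  hf.imp fun _ h x => h (e x)

lemma add (hf : Bdd f) (hg : Bdd g) : Bdd (fun x => f x + g x) := by
  obtain ⟨C, hC⟩ := hf
  obtain ⟨D, hD⟩ := hg
  exact ⟨C + D, fun x => (abs_add_le _ _).trans (add_le_add (hC x) (hD x))⟩

lemma mul (hf : Bdd f) (hg : Bdd g) : Bdd (fun x => f x * g x) := by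
  obtain ⟨C, hC⟩ := hf
  obtain ⟨D, hD⟩ := hg
  refine ⟨C * D, fun x => ?_⟩
  rw [abs_mul]
  exact mul_le_mul (hC x) (hD x) (abs_nonneg _) ((abs_nonneg _).trans (hC x))

lemma smul (hf : Bdd f) (c : ℝ) : Bdd (fun x => c * f x) := (const c).mul hf

lemma sub (hf : Bdd f) (hg : Bdd g) : Bdd (fun x => f x - g x) := by
  simpa [sub_eq_add_neg] using hf.add (hg.smul (-1))

lemma sq (hf : Bdd f) : Bdd (fun x => f x ^ 2) := by
  simpa [pow_two] using hf.mul hf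

end Bdd

/-- The space of bounded real functions. -/
def bddSubmodule (α : Type*) : Submodule ℝ (α → ℝ) where
  carrier := {f | Bdd f}
  add_mem' := Bdd.add
  zero_mem' := Bdd.const 0
  smul_mem' c _ hf := hf.smul c

/-- The vector space of bounded real functions, without the topology of pointwise convergence. -/
def BddFun (α : Type*) : Type _ := bddSubmodule α

noncomputable instance (α : Type*) : AddCommGroup (BddFun α) :=
  inferInstanceAs (AddCommGroup (bddSubmodule α))

noncomputable instance (α : Type*) : Module ℝ (BddFun α) :=
  inferInstanceAs (Module ℝ (bddSubmodule α))

/-- A bounded function as an element of `BddFun`. -/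
def Bdd.toBddFun {α : Type*} {f : α → ℝ} (hf : Bdd f) : BddFun α := ⟨f, hf⟩

/-- A mean: a linear functional that is normalized and positive on bounded functions. Its values on
unbounded functions carry no information. -/
structure IsMean {α : Type*} (m : (α → ℝ) →ₗ[ℝ] ℝ) : Prop where
  one : m (fun _ => 1) = 1
  nonneg : ∀ f, Bdd f → (∀ x, 0 ≤ f x) → 0 ≤ m f

namespace IsMean

variable {α β : Type*} {m : (α → ℝ) →ₗ[ℝ] ℝ} {f g : α → ℝ}

lemma map_const (hm : IsMean m) (c : ℝ) : m (fun _ => c) = c := by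
  have h : (fun _ : α => c) = c • (fun _ : α => (1 : ℝ)) := by ext; simp
  rw [h, map_smul, hm.one, smul_eq_mul, mul_one]

lemma mono (hm : IsMean m) (hf : Bdd f) (hg : Bdd g) (h : ∀ x, f x ≤ g x) : m f ≤ m g := by
  have := hm.nonneg _ (hg.sub hf) fun x => sub_nonneg.2 (h x)
  have e : (fun x => g x - f x) = g - f := rfl
  rw [e, map_sub] at this
  linarith

lemma abs_le (hm : IsMean m) {C : ℝ} (h : ∀ x, |f x| ≤ C) : |m f| ≤ C := by
  have hf : Bdd f := ⟨C, h⟩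
  have h1 := hm.mono hf (Bdd.const C) fun x => (le_abs_self _).trans (h x)
  have h2 := hm.mono (Bdd.const (-C)) hf fun x => (_root_.abs_le.1 (h x)).1
  rw [hm.map_const] at h1 h2
  exact _root_.abs_le.2 ⟨h2, h1⟩

lemma bdd_uncurry (hm : IsMean m) {F : β → α → ℝ} (hF : Bdd (fun p : β × α => F p.1 p.2)) :
    Bdd (fun b => m (F b)) := by
  obtain ⟨C, hC⟩ := hF
  exact ⟨C, fun b => hm.abs_le fun a => hC (b, a)⟩

end IsMean

/-- The pre-inner product on bounded functions induced by a mean. -/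
noncomputable abbrev IsMean.core {α : Type*} {m : (α → ℝ) →ₗ[ℝ] ℝ} (hm : IsMean m) :
    PreInnerProductSpace.Core ℝ (BddFun α) where
  inner f g := m (fun x => f.1 x * g.1 x)
  conj_inner_symm f g := by simp [mul_comm]
  re_inner_nonneg f := hm.nonneg _ (f.2.mul f.2) fun x => mul_self_nonneg _
  add_left f g h := by
    rw [← map_add]
    exact congrArg m (funext fun x => add_mul (f.1 x) (g.1 x) (h.1 x))
  smul_left f g c := by
    change m _ = c * m _
    rw [← smul_eq_mul, ← map_smul]
    exact congrArg m (funext fun x => mul_assoc c (f.1 x) (g.1 x))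

/-- The GNS construction: bounded functions map to a Hilbert space in which the inner product is
the mean of the product. -/
lemma IsMean.exists_hilbert {α : Type u} {m : (α → ℝ) →ₗ[ℝ] ℝ} (hm : IsMean m) :
    ∃ (E : Type u) (_ : NormedAddCommGroup E) (_ : InnerProductSpace ℝ E) (_ : CompleteSpace E)
      (ι : (α → ℝ) → E), ∀ f g, Bdd f → Bdd g →
        inner ℝ (ι f) (ι g) = m (fun x => f x * g x) := by
  classical
  let : SeminormedAddCommGroup (BddFun α) :=
    InnerProductSpace.Core.toSeminormedAddCommGroup (c := hm.core)
  let : InnerProductSpace ℝ (BddFun α) := InnerProductSpace.ofCore hm.core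
  refine ⟨UniformSpace.Completion (BddFun α), inferInstance, inferInstance, inferInstance,
    fun f => if hf : Bdd f then (hf.toBddFun : UniformSpace.Completion _) else 0,
    fun f g hf hg => ?_⟩
  beta_reduce
  rw [dif_pos hf, dif_pos hg, UniformSpace.Completion.inner_coe]
  rfl

/-- **Cauchy–Schwarz** for a mean. -/
lemma IsMean.sq_mul_le {α : Type*} {m : (α → ℝ) →ₗ[ℝ] ℝ} (hm : IsMean m) {f g : α → ℝ}
    (hf : Bdd f) (hg : Bdd g) :
    m (fun x => f x * g x) ^ 2 ≤ m (fun x => f x ^ 2) * m (fun x => g x ^ 2) := by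
  obtain ⟨E, _, _, _, ι, hι⟩ := hm.exists_hilbert
  have := real_inner_mul_inner_self_le (ι f) (ι g)
  rw [hι f g hf hg, hι f f hf hf, hι g g hg hg] at this
  simpa [pow_two] using this

lemma IsMean.sq_le {α : Type*} {m : (α → ℝ) →ₗ[ℝ] ℝ} (hm : IsMean m) {f : α → ℝ}
    (hf : Bdd f) : m f ^ 2 ≤ m (fun x => f x ^ 2) := by
  simpa [hm.map_const] using hm.sq_mul_le hf (Bdd.const 1)

/-- If `g` is bounded by `1`, the mean of `f * g` is at most the `L²` seminorm of `f`. -/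
lemma IsMean.abs_mul_le {α : Type*} {m : (α → ℝ) →ₗ[ℝ] ℝ} (hm : IsMean m) {f g : α → ℝ}
    (hf : Bdd f) (hg : ∀ x, |g x| ≤ 1) {ε : ℝ} (hε : 0 ≤ ε) (h : m (fun x => f x ^ 2) ≤ ε ^ 2) :
    |m (fun x => f x * g x)| ≤ ε := by
  have hgb : Bdd g := ⟨1, hg⟩
  have h1 : m (fun x => g x ^ 2) ≤ 1 := by
    rw [← hm.map_const 1]
    exact hm.mono hgb.sq (Bdd.const 1) fun x => (sq_le_one_iff_abs_le_one _).2 (hg x)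
  have h0 := hm.nonneg _ hf.sq fun x => sq_nonneg _
  refine abs_le_of_sq_le_sq ((hm.sq_mul_le hf hgb).trans ?_) hε
  nlinarith

/-- A Cauchy–Schwarz inequality for averages `θ` of inner products with a bounded family of
functions; `θ` may be any functional that is bounded on bounded functions. -/
lemma IsMean.sq_average_le {α β : Type*} {m : (α → ℝ) →ₗ[ℝ] ℝ} (hm : IsMean m)
    {θ : (β → ℝ) →ₗ[ℝ] ℝ} {B : ℝ} (hθ : ∀ (F : β → ℝ) (C : ℝ), (∀ b, |F b| ≤ C) → |θ F| ≤ B * C)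
    {v : β → α → ℝ} (hv : ∀ b x, |v b x| ≤ 1) {φ : α → ℝ} (hφ : Bdd φ) :
    θ (fun b => m (fun x => φ x * v b x)) ^ 2 ≤
      m (fun x => φ x ^ 2) * θ (fun b => θ (fun b' => m (fun x => v b x * v b' x))) := by
  obtain ⟨E, _, _, _, ι, hι⟩ := hm.exists_hilbert
  have hvb : ∀ b, Bdd (v b) := fun b => ⟨1, hv b⟩
  have hnorm : ∀ b, ‖ι (v b)‖ ≤ 1 := fun b => by
    rw [← sq_le_one_iff₀ (norm_nonneg _), ← real_inner_self_eq_norm_sq, hι _ _ (hvb b) (hvb b)]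
    exact (le_abs_self _).trans (hm.abs_le fun x => abs_mul_le_one (hv b x) (hv b x))
  let L₀ : E →ₗ[ℝ] ℝ :=
    θ ∘ₗ LinearMap.pi fun b => ((innerSL ℝ (ι (v b))) : E →ₗ[ℝ] ℝ)
  have hL₀ : ∀ e, L₀ e = θ (fun b => inner ℝ (ι (v b)) e) := fun e => rfl
  let L : E →L[ℝ] ℝ := L₀.mkContinuous B fun e => by
    rw [hL₀, Real.norm_eq_abs]
    refine hθ _ _ fun b => (abs_real_inner_le_norm _ _).trans ?_
    exact mul_le_of_le_one_left (norm_nonneg _) (hnorm b)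
  have hL : ∀ e, L e = θ (fun b => inner ℝ (ι (v b)) e) := fun e => rfl
  let D : E := (InnerProductSpace.toDual ℝ E).symm L
  have hD : ∀ e, inner ℝ D e = θ (fun b => inner ℝ (ι (v b)) e) := fun e => by
    rw [← hL, InnerProductSpace.toDual_symm_apply]
  have key := real_inner_mul_inner_self_le D (ι φ)
  rw [hD D] at key
  have e1 : inner ℝ D (ι φ) = θ (fun b => m (fun x => φ x * v b x)) := by
    rw [hD]
    congr 1
    ext b
    rw [hι _ _ (hvb b) hφ]
    simp only [mul_comm]
  have e2 : (fun b => inner ℝ (ι (v b)) D) =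
      fun b => θ (fun b' => m (fun x => v b x * v b' x)) := by
    ext b
    rw [real_inner_comm, hD]
    congr 1
    ext b'
    rw [hι _ _ (hvb b') (hvb b)]
    simp only [mul_comm]
  rw [e1, e2, hι _ _ hφ hφ] at key
  simpa only [pow_two, mul_comm] using key

/-- If two means agree on the averaged correlations of `v`, then they agree on the
averages of the inner products with `v`. -/
lemma IsMean.average_eq {α β : Type*} {m : (α → ℝ) →ₗ[ℝ] ℝ} (hm : IsMean m)
    {θ₁ θ₂ : (β → ℝ) →ₗ[ℝ] ℝ} (h₁ : IsMean θ₁) (h₂ : IsMean θ₂)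
    {v : β → α → ℝ} (hv : ∀ b x, |v b x| ≤ 1)
    (h₁₁ : θ₁ (fun b => θ₁ (fun b' => m (fun x => v b x * v b' x))) =
      θ₂ (fun b => θ₁ (fun b' => m (fun x => v b x * v b' x))))
    (h₂₂ : θ₁ (fun b => θ₂ (fun b' => m (fun x => v b x * v b' x))) =
      θ₂ (fun b => θ₂ (fun b' => m (fun x => v b x * v b' x))))
    {φ : α → ℝ} (hφ : Bdd φ) :
    θ₁ (fun b => m (fun x => φ x * v b x)) = θ₂ (fun b => m (fun x => φ x * v b x)) := by
  have hB : ∀ (F : β → ℝ) (C : ℝ), (∀ b, |F b| ≤ C) → |(θ₁ - θ₂) F| ≤ 2 * C := by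
    intro F C hF
    rw [LinearMap.sub_apply]
    linarith [abs_sub (θ₁ F) (θ₂ F), h₁.abs_le hF, h₂.abs_le hF]
  have key := hm.sq_average_le hB hv hφ
  have e : (fun b => (θ₁ - θ₂) (fun b' => m (fun x => v b x * v b' x))) =
      (fun b => θ₁ (fun b' => m (fun x => v b x * v b' x))) -
        fun b => θ₂ (fun b' => m (fun x => v b x * v b' x)) := rfl
  rw [e, map_sub, LinearMap.sub_apply _ _ (fun b => θ₁ _), LinearMap.sub_apply _ _ (fun b => θ₂ _),
    h₁₁, h₂₂, sub_self, sub_self, sub_self, mul_zero, LinearMap.sub_apply] at key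
  exact sub_eq_zero.1 (pow_eq_zero_iff two_ne_zero |>.1 (le_antisymm key (sq_nonneg _)))

/-- The iterated mean `F ↦ θ_b m_a F (b, a)`. -/
noncomputable def iterMean {α β : Type*} (θ : (β → ℝ) →ₗ[ℝ] ℝ) (m : (α → ℝ) →ₗ[ℝ] ℝ) :
    (β × α → ℝ) →ₗ[ℝ] ℝ :=
  θ ∘ₗ LinearMap.pi fun b => m ∘ₗ LinearMap.funLeft ℝ ℝ fun a => (b, a)

lemma iterMean_apply {α β : Type*} (θ : (β → ℝ) →ₗ[ℝ] ℝ) (m : (α → ℝ) →ₗ[ℝ] ℝ)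
    (F : β × α → ℝ) : iterMean θ m F = θ (fun b => m (fun a => F (b, a))) := rfl

lemma IsMean.iterMean {α β : Type*} {θ : (β → ℝ) →ₗ[ℝ] ℝ} {m : (α → ℝ) →ₗ[ℝ] ℝ}
    (hθ : IsMean θ) (hm : IsMean m) : IsMean (iterMean θ m) where
  one := by rw [iterMean_apply, hm.one, hθ.one]
  nonneg F hF h := hθ.nonneg _ (hm.bdd_uncurry hF) fun b =>
    hm.nonneg _ (hF.comp fun a => (b, a)) fun a => h (b, a)

/-- Invariance of a functional under left translations of bounded functions. -/
def IsLeftInv {H : Type*} [Group H] (θ : (H → ℝ) →ₗ[ℝ] ℝ) : Prop :=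
  ∀ (h : H) (F : H → ℝ), Bdd F → θ (fun x => F (h * x)) = θ F

/-- Invariance of a functional under right translations of bounded functions. -/
def IsRightInv {H : Type*} [Group H] (m : (H → ℝ) →ₗ[ℝ] ℝ) : Prop :=
  ∀ (h : H) (F : H → ℝ), Bdd F → m (fun x => F (x * h)) = m F

lemma IsLeftInv.iterMean {G H : Type*} [Group G] [Group H] {θ : (G → ℝ) →ₗ[ℝ] ℝ}
    {η : (H → ℝ) →ₗ[ℝ] ℝ} (hη : IsMean η) (hθi : IsLeftInv θ) (hηi : IsLeftInv η) :
    IsLeftInv (iterMean θ η) := by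
  intro p F hF
  simp only [iterMean_apply]
  rw [← hθi p.1 (fun g => η (fun h => F (g, h))) (hη.bdd_uncurry hF)]
  congr 1
  ext g
  exact hηi p.2 _ (hF.comp fun h => (p.1 * g, h))

/-- A right action of a group on a space by transformations that preserve a given mean. -/
structure IsMeanAction {K α : Type*} [Group K] (m : (α → ℝ) →ₗ[ℝ] ℝ) (τ : K → α → α) : Prop where
  comp : ∀ k l x, τ l (τ k x) = τ (k * l) x
  one : ∀ x, τ 1 x = x
  inv : ∀ k F, Bdd F → m (fun x => F (τ k x)) = m F

lemma abs_le_of_mem_convexHull {α : Type*} {s : Set (α → ℝ)} {C : ℝ}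
    (hs : ∀ F ∈ s, ∀ x, |F x| ≤ C) {F : α → ℝ} (hF : F ∈ convexHull ℝ s) (x : α) : |F x| ≤ C := by
  refine convexHull_min (t := {F : α → ℝ | ∀ x, |F x| ≤ C}) (fun F hF => hs F hF) ?_ hF x
  intro F hF F' hF' a b ha hb hab y
  have e : a * C + b * C = C := by rw [← add_mul, hab, one_mul]
  calc |a * F y + b * F' y| ≤ |a * F y| + |b * F' y| := abs_add_le _ _
    _ = a * |F y| + b * |F' y| := by rw [abs_mul, abs_mul, abs_of_nonneg ha, abs_of_nonneg hb]
    _ ≤ C := by rw [← e]; gcongr; exacts [hF y, hF' y]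

/-- The convex hull of the orbit of a bounded function contains almost invariant functions. -/
lemma IsMeanAction.exists_almost_inv {K α : Type*} [Group K] {m : (α → ℝ) →ₗ[ℝ] ℝ}
    (hm : IsMean m) {τ : K → α → α} (hτ : IsMeanAction m τ) {F : α → ℝ} {C : ℝ}
    (hF : ∀ x, |F x| ≤ C) {ε : ℝ} (hε : 0 < ε) :
    ∃ F' ∈ convexHull ℝ (Set.range fun k x => F (τ k x)), (∀ x, |F' x| ≤ C) ∧
      ∀ k, m (fun x => (F' (τ k x) - F' x) ^ 2) ≤ ε := by
  set W := convexHull ℝ (Set.range fun k x => F (τ k x)) with hW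
  have hconv : Convex ℝ W := convex_convexHull _ _
  have hWC : ∀ F' ∈ W, ∀ x, |F' x| ≤ C := fun F' hF' =>
    abs_le_of_mem_convexHull (by rintro _ ⟨k, rfl⟩ x; exact hF _) hF'
  have hWB : ∀ F' ∈ W, Bdd F' := fun F' hF' => ⟨C, hWC F' hF'⟩
  have hWτ : ∀ k, ∀ F' ∈ W, (fun x => F' (τ k x)) ∈ W := by
    intro k F' hF'
    refine convexHull_min (t := {F' | (fun x => F' (τ k x)) ∈ W}) ?_ ?_ hF'
    · rintro _ ⟨l, rfl⟩
      refine subset_convexHull _ _ ⟨k * l, ?_⟩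
      simp only [hτ.comp]
    · intro F₁ h₁ F₂ h₂ a b ha hb hab
      exact hconv h₁ h₂ ha hb hab
  set r := sInf ((fun F' : α → ℝ => m (fun x => F' x ^ 2)) '' W) with hr
  have hbdd : BddBelow ((fun F' : α → ℝ => m (fun x => F' x ^ 2)) '' W) := by
    refine ⟨0, ?_⟩
    rintro _ ⟨F', hF', rfl⟩
    exact hm.nonneg _ (hWB F' hF').sq fun x => sq_nonneg _
  have hne : ((fun F' : α → ℝ => m (fun x => F' x ^ 2)) '' W).Nonempty :=
    ⟨_, _, subset_convexHull _ _ ⟨1, rfl⟩, rfl⟩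
  obtain ⟨_, ⟨F', hF', rfl⟩, hlt⟩ := exists_lt_of_csInf_lt hne
    (show r < r + ε / 4 by linarith)
  refine ⟨F', hF', hWC F' hF', fun k => ?_⟩
  have hmid : (fun x => (1 / 2 : ℝ) * F' (τ k x) + (1 / 2 : ℝ) * F' x) ∈ W :=
    hconv (hWτ k F' hF') hF' (by norm_num) (by norm_num) (by norm_num)
  have hmid' : r ≤ m (fun x => ((1 / 2 : ℝ) * F' (τ k x) + (1 / 2 : ℝ) * F' x) ^ 2) :=
    csInf_le hbdd ⟨_, hmid, rfl⟩
  have hinv : m (fun x => F' (τ k x) ^ 2) = m (fun x => F' x ^ 2) :=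
    hτ.inv k _ (hWB F' hF').sq
  have hpar : (fun x => (F' (τ k x) - F' x) ^ 2) = (2 : ℝ) • (fun x => F' (τ k x) ^ 2) +
      (2 : ℝ) • (fun x => F' x ^ 2) -
      (4 : ℝ) • fun x => ((1 / 2 : ℝ) * F' (τ k x) + (1 / 2 : ℝ) * F' x) ^ 2 := by
    ext x
    simp only [Pi.sub_apply, Pi.add_apply, Pi.smul_apply, smul_eq_mul]
    ring
  rw [hpar, map_sub, map_add, map_smul, map_smul, map_smul, hinv]
  simp only [smul_eq_mul] at hlt ⊢
  linarith

/-- All left-invariant means assign the same value to the function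
`p ↦ M (γ · T_{p₁⁻¹} α · S_{p₂⁻¹} β)`. -/
lemma IsMeanAction.leftInv_eq {G X : Type*} [Group G] {M : (X → ℝ) →ₗ[ℝ] ℝ} (hM : IsMean M)
    {τ σ : G → X → X} (hτ : IsMeanAction M τ) (hσ : IsMeanAction M σ) {α β γ : X → ℝ}
    (hα : ∀ x, |α x| ≤ 1) (hβ : ∀ x, |β x| ≤ 1) (hγ : ∀ x, |γ x| ≤ 1)
    {θ₁ θ₂ : (G × G → ℝ) →ₗ[ℝ] ℝ} (h₁ : IsMean θ₁) (h₂ : IsMean θ₂) (i₁ : IsLeftInv θ₁)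
    (i₂ : IsLeftInv θ₂) :
    θ₁ (fun p => M (fun x => γ x * α (τ p.1⁻¹ x) * β (σ p.2⁻¹ x))) =
      θ₂ (fun p => M (fun x => γ x * α (τ p.1⁻¹ x) * β (σ p.2⁻¹ x))) := by
  have close : ∀ ε > 0, ∃ c, ∀ θ : (G × G → ℝ) →ₗ[ℝ] ℝ, IsMean θ → IsLeftInv θ →
      |θ (fun p => M (fun x => γ x * α (τ p.1⁻¹ x) * β (σ p.2⁻¹ x))) - c| ≤ ε + ε := by
    intro ε hε
    obtain ⟨α', hα', hα'1, hα'ε⟩ := hτ.exists_almost_inv hM hα (pow_pos hε 2)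
    obtain ⟨β', hβ', hβ'1, hβ'ε⟩ := hσ.exists_almost_inv hM hβ (pow_pos hε 2)
    refine ⟨M (fun x => γ x * α' x * β' x), fun θ hθ iθ => ?_⟩
    have e1 : θ (fun p => M (fun x => γ x * α' (τ p.1⁻¹ x) * β (σ p.2⁻¹ x))) =
        θ (fun p => M (fun x => γ x * α (τ p.1⁻¹ x) * β (σ p.2⁻¹ x))) := by
      refine convexHull_min (t := {α' | θ (fun p => M (fun x =>
        γ x * α' (τ p.1⁻¹ x) * β (σ p.2⁻¹ x))) = θ (fun p => M (fun x =>
        γ x * α (τ p.1⁻¹ x) * β (σ p.2⁻¹ x)))}) ?_ ?_ hα'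
      · rintro _ ⟨k, rfl⟩
        have hb : Bdd (fun p : G × G => M (fun x => γ x * α (τ p.1⁻¹ x) * β (σ p.2⁻¹ x))) :=
          ⟨1, fun p => hM.abs_le fun x => abs_mul_le_one (abs_mul_le_one (hγ _) (hα _)) (hβ _)⟩
        rw [Set.mem_ofPred_eq, ← iθ (k⁻¹, 1) _ hb]
        simp [hτ.comp]
      · intro f₁ hf₁ f₂ hf₂ a b ha hb hab
        rw [Set.mem_ofPred_eq] at hf₁ hf₂ ⊢
        have hlin : (fun p : G × G => M (fun x =>
            γ x * (a • f₁ + b • f₂) (τ p.1⁻¹ x) * β (σ p.2⁻¹ x))) =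
            a • (fun p : G × G => M (fun x => γ x * f₁ (τ p.1⁻¹ x) * β (σ p.2⁻¹ x))) +
            b • (fun p : G × G => M (fun x => γ x * f₂ (τ p.1⁻¹ x) * β (σ p.2⁻¹ x))) := by
          ext p
          rw [Pi.add_apply, Pi.smul_apply, Pi.smul_apply, ← map_smul, ← map_smul, ← map_add]
          congr 1
          ext x
          simp only [Pi.add_apply, Pi.smul_apply, smul_eq_mul]
          ring
        rw [hlin, map_add, map_smul, map_smul, hf₁, hf₂, ← add_smul, hab, one_smul]
    have e2 : θ (fun p => M (fun x => γ x * α' (τ p.1⁻¹ x) * β' (σ p.2⁻¹ x))) =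
        θ (fun p => M (fun x => γ x * α' (τ p.1⁻¹ x) * β (σ p.2⁻¹ x))) := by
      refine convexHull_min (t := {β' | θ (fun p => M (fun x =>
        γ x * α' (τ p.1⁻¹ x) * β' (σ p.2⁻¹ x))) = θ (fun p => M (fun x =>
        γ x * α' (τ p.1⁻¹ x) * β (σ p.2⁻¹ x)))}) ?_ ?_ hβ'
      · rintro _ ⟨k, rfl⟩
        have hb : Bdd (fun p : G × G => M (fun x => γ x * α' (τ p.1⁻¹ x) * β (σ p.2⁻¹ x))) :=
          ⟨1, fun p => hM.abs_le fun x => abs_mul_le_one (abs_mul_le_one (hγ _) (hα'1 _)) (hβ _)⟩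
        rw [Set.mem_ofPred_eq, ← iθ (1, k⁻¹) _ hb]
        simp [hσ.comp]
      · intro f₁ hf₁ f₂ hf₂ a b ha hb hab
        rw [Set.mem_ofPred_eq] at hf₁ hf₂ ⊢
        have hlin : (fun p : G × G => M (fun x =>
            γ x * α' (τ p.1⁻¹ x) * (a • f₁ + b • f₂) (σ p.2⁻¹ x))) =
            a • (fun p : G × G => M (fun x => γ x * α' (τ p.1⁻¹ x) * f₁ (σ p.2⁻¹ x))) +
            b • (fun p : G × G => M (fun x => γ x * α' (τ p.1⁻¹ x) * f₂ (σ p.2⁻¹ x))) := by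
          ext p
          rw [Pi.add_apply, Pi.smul_apply, Pi.smul_apply, ← map_smul, ← map_smul, ← map_add]
          congr 1
          ext x
          simp only [Pi.add_apply, Pi.smul_apply, smul_eq_mul]
          ring
        rw [hlin, map_add, map_smul, map_smul, hf₁, hf₂, ← add_smul, hab, one_smul]
    have hα'b : Bdd α' := ⟨1, hα'1⟩
    have hβ'b : Bdd β' := ⟨1, hβ'1⟩
    rw [← e1, ← e2, ← hθ.map_const (M _), ← map_sub]
    refine hθ.abs_le fun p => ?_
    have hsplit : (fun x => γ x * α' (τ p.1⁻¹ x) * β' (σ p.2⁻¹ x)) - (fun x => γ x * α' x * β' x) =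
        (fun x => (α' (τ p.1⁻¹ x) - α' x) * (γ x * β' (σ p.2⁻¹ x))) +
        fun x => (β' (σ p.2⁻¹ x) - β' x) * (γ x * α' x) := by
      ext x
      simp only [Pi.add_apply, Pi.sub_apply]
      ring
    rw [Pi.sub_apply, ← map_sub, hsplit, map_add]
    refine (abs_add_le _ _).trans (add_le_add ?_ ?_)
    · exact hM.abs_mul_le ((hα'b.comp _).sub hα'b) (fun x => abs_mul_le_one (hγ _) (hβ'1 _)) hε.le
        (hα'ε _)
    · exact hM.abs_mul_le ((hβ'b.comp _).sub hβ'b) (fun x => abs_mul_le_one (hγ _) (hα'1 _)) hε.le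
        (hβ'ε _)
  refine eq_of_forall_dist_le fun ε hε => ?_
  obtain ⟨c, hc⟩ := close (ε / 4) (by linarith)
  rw [Real.dist_eq]
  have := abs_sub_le (θ₁ (fun p => M (fun x => γ x * α (τ p.1⁻¹ x) * β (σ p.2⁻¹ x)))) c
    (θ₂ (fun p => M (fun x => γ x * α (τ p.1⁻¹ x) * β (σ p.2⁻¹ x))))
  rw [abs_sub_comm c] at this
  linarith [hc θ₁ h₁ i₁, hc θ₂ h₂ i₂]

/-- **Khintchine's recurrence theorem** for means. -/
lemma IsMeanAction.sq_le_leftInv {K α : Type*} [Group K] {m : (α → ℝ) →ₗ[ℝ] ℝ}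
    (hm : IsMean m) {σ : K → α → α} (hσ : IsMeanAction m σ) {F : α → ℝ} (hF : ∀ x, |F x| ≤ 1)
    {η : (K → ℝ) →ₗ[ℝ] ℝ} (hη : IsMean η) (iη : IsLeftInv η) :
    m F ^ 2 ≤ η (fun h => m (fun x => F x * F (σ h x))) := by
  have hFb : Bdd F := ⟨1, hF⟩
  have key := hm.sq_average_le (θ := η) (B := 1) (fun f C hf => by rw [one_mul]; exact hη.abs_le hf)
    (v := fun k x => F (σ k x)) (fun k x => hF _) (Bdd.const 1)
  simp only [one_mul, one_pow, hm.one] at key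
  have e1 : (fun k => m (fun x => F (σ k x))) = fun _ => m F := by
    ext k
    exact hσ.inv k F hFb
  have e2 : (fun k => η (fun k' => m (fun x => F (σ k x) * F (σ k' x)))) =
      fun _ => η (fun h => m (fun x => F x * F (σ h x))) := by
    ext k
    have hb : Bdd (fun h => m (fun x => F x * F (σ h x))) :=
      ⟨1, fun h => hm.abs_le fun x => abs_mul_le_one (hF _) (hF _)⟩
    rw [← iη k⁻¹ _ hb]
    congr 1
    ext k'
    rw [← hσ.inv k _ (hFb.mul (hFb.comp (σ (k⁻¹ * k'))))]
    simp only [hσ.comp, mul_inv_cancel_left]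
  rwa [e1, e2, hη.map_const, hη.map_const] at key

/-- The three shifted factors in the correlation defining the square averages. -/
def squareFactor {G : Type*} [Group G] (f : G × G → ℝ) (p x : G × G) : ℝ :=
  f (x.1 * p.1, x.2) * f (x.1, x.2 * p.2) * f (x * p)

/-- The correlation of `f` along the squares with sides `p`. -/
noncomputable def squareCorr {G : Type*} [Group G] (m : (G × G → ℝ) →ₗ[ℝ] ℝ) (f : G × G → ℝ)
    (p : G × G) : ℝ :=
  m (fun x => f x * squareFactor f p x)

section squares

variable {G : Type*} [Group G] {m : (G × G → ℝ) →ₗ[ℝ] ℝ} {f : G × G → ℝ}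

lemma abs_squareFactor_le (hf : ∀ x, |f x| ≤ 1) (p x : G × G) : |squareFactor f p x| ≤ 1 :=
  abs_mul_le_one (abs_mul_le_one (hf _) (hf _)) (hf _)

lemma IsRightInv.isMeanAction_fst (hmi : IsRightInv m) :
    IsMeanAction m (fun (g : G) (x : G × G) => (x.1 * g, x.2)) where
  comp k l x := by simp [mul_assoc]
  one x := by simp
  inv k F hF := by simpa [Prod.mul_def] using hmi (k, 1) F hF

lemma IsRightInv.isMeanAction_snd (hmi : IsRightInv m) :
    IsMeanAction m (fun (g : G) (x : G × G) => (x.1, x.2 * g)) where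
  comp k l x := by simp [mul_assoc]
  one x := by simp
  inv k F hF := by simpa [Prod.mul_def] using hmi (1, k) F hF

lemma IsMeanAction.iterMean {K α β : Type*} [Group K] {m : (α → ℝ) →ₗ[ℝ] ℝ} {τ : K → α → α}
    (hτ : IsMeanAction m τ) (θ : (β → ℝ) →ₗ[ℝ] ℝ) :
    IsMeanAction (iterMean θ m) (fun k (x : β × α) => (x.1, τ k x.2)) where
  comp k l x := by simp [hτ.comp]
  one x := by simp [hτ.one]
  inv k F hF := by
    simp only [iterMean_apply]
    congr 1
    ext b
    exact hτ.inv k _ (hF.comp fun a => (b, a))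

lemma squareCorr_inv (hf : ∀ x, |f x| ≤ 1) (hmi : IsRightInv m) (p : G × G) :
    squareCorr m f p⁻¹ = squareCorr m f p := by
  have hfb : Bdd f := ⟨1, hf⟩
  have hb : Bdd (fun x => f x * squareFactor f p⁻¹ x) :=
    hfb.mul ⟨1, abs_squareFactor_le hf _⟩
  rw [squareCorr, ← hmi p _ hb, squareCorr]
  congr 1
  ext x
  simp only [squareFactor, Prod.fst_mul, Prod.snd_mul, Prod.fst_inv, Prod.snd_inv,
    mul_inv_cancel_right]
  rw [Prod.mul_def]
  ring

/-- All left-invariant means assign the same value to the averaged correlations of the family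
`squareFactor f`. -/
lemma average_squareFactor_mul_eq (hm : IsMean m) (hmi : IsRightInv m) (hf : ∀ x, |f x| ≤ 1)
    {θ θ₁ θ₂ : (G × G → ℝ) →ₗ[ℝ] ℝ} (hθ : IsMean θ) (iθ : IsLeftInv θ) (h₁ : IsMean θ₁)
    (h₂ : IsMean θ₂) (i₁ : IsLeftInv θ₁) (i₂ : IsLeftInv θ₂) :
    θ₁ (fun p => θ (fun q => m (fun x => squareFactor f p x * squareFactor f q x))) =
      θ₂ (fun p => θ (fun q => m (fun x => squareFactor f p x * squareFactor f q x))) := by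
  have key := (hmi.isMeanAction_fst.iterMean θ).leftInv_eq (hθ.iterMean hm)
    (hmi.isMeanAction_snd.iterMean θ)
    (α := fun z => f z.2 * f (z.2.1, z.2.2 * z.1.2))
    (β := fun z => f z.2 * f (z.2.1 * z.1.1, z.2.2))
    (γ := fun z => f z.2 * f (z.2 * z.1))
    (fun z => abs_mul_le_one (hf _) (hf _)) (fun z => abs_mul_le_one (hf _) (hf _))
    (fun z => abs_mul_le_one (hf _) (hf _)) h₁ h₂ i₁ i₂
  convert key using 3 with p p
  all_goals
    rw [iterMean_apply, ← iθ p]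
    · congr 1
      ext q
      rw [← hmi p⁻¹]
      · congr 1
        ext x
        simp only [squareFactor, Prod.fst_inv, Prod.snd_inv,
          inv_mul_cancel_right, Prod.mul_def, Prod.mk.eta, ← mul_assoc]
        ring
      · exact ⟨1, fun x => abs_mul_le_one (abs_squareFactor_le hf _ _) (abs_squareFactor_le hf _ _)⟩
    · exact ⟨1, fun q => hm.abs_le fun x =>
        abs_mul_le_one (abs_squareFactor_le hf _ _) (abs_squareFactor_le hf _ _)⟩

/-- All left-invariant means assign the same value to the square correlations. -/
lemma average_squareCorr_eq (hm : IsMean m) (hmi : IsRightInv m) (hf : ∀ x, |f x| ≤ 1)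
    {θ₁ θ₂ : (G × G → ℝ) →ₗ[ℝ] ℝ} (h₁ : IsMean θ₁) (h₂ : IsMean θ₂) (i₁ : IsLeftInv θ₁)
    (i₂ : IsLeftInv θ₂) : θ₁ (squareCorr m f) = θ₂ (squareCorr m f) :=
  hm.average_eq h₁ h₂ (abs_squareFactor_le hf)
    (average_squareFactor_mul_eq hm hmi hf h₁ i₁ h₁ h₂ i₁ i₂)
    (average_squareFactor_mul_eq hm hmi hf h₂ i₂ h₁ h₂ i₁ i₂) ⟨1, hf⟩

/-- The iterated average of the square correlations of `f` is at least the fourth power of the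
mean of `f`. -/
lemma pow_four_le_iterMean_squareCorr (hm : IsMean m) (hmi : IsRightInv m) (hf : ∀ x, |f x| ≤ 1)
    {η₁ η₂ : (G → ℝ) →ₗ[ℝ] ℝ} (h₁ : IsMean η₁) (h₂ : IsMean η₂) (i₁ : IsLeftInv η₁)
    (i₂ : IsLeftInv η₂) : m f ^ 4 ≤ iterMean η₁ η₂ (squareCorr m f) := by
  have hfb : Bdd f := ⟨1, hf⟩
  have hcorr : ∀ g, |m (fun x => f x * f (x.1 * g, x.2))| ≤ 1 := fun g =>
    hm.abs_le fun x => abs_mul_le_one (hf _) (hf _)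
  have hsq : ∀ p, |squareCorr m f p| ≤ 1 := fun p =>
    hm.abs_le fun x => abs_mul_le_one (hf _) (abs_squareFactor_le hf _ _)
  have inner : ∀ g, m (fun x => f x * f (x.1 * g, x.2)) ^ 2 ≤
      η₂ (fun h => squareCorr m f (g, h)) := by
    intro g
    refine (hmi.isMeanAction_snd.sq_le_leftInv hm (F := fun x => f x * f (x.1 * g, x.2))
      (fun x => abs_mul_le_one (hf _) (hf _)) h₂ i₂).trans_eq ?_
    congr 1
    ext h
    rw [squareCorr]
    congr 1
    ext x
    simp only [squareFactor, Prod.mul_def]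
    ring
  calc m f ^ 4 = (m f ^ 2) ^ 2 := by ring
    _ ≤ (η₁ (fun g => m (fun x => f x * f (x.1 * g, x.2)))) ^ 2 := by
      gcongr
      exact hmi.isMeanAction_fst.sq_le_leftInv hm hf h₁ i₁
    _ ≤ η₁ (fun g => m (fun x => f x * f (x.1 * g, x.2)) ^ 2) := h₁.sq_le ⟨1, hcorr⟩
    _ ≤ η₁ (fun g => η₂ (fun h => squareCorr m f (g, h))) :=
      h₁.mono (Bdd.sq ⟨1, hcorr⟩) ⟨1, fun g => h₂.abs_le fun h => hsq _⟩ inner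

end squares

lemma abs_average_le {α : Type*} {s : Finset α} (hs : s.Nonempty) {f : α → ℝ} {C : ℝ}
    (hf : ∀ x, |f x| ≤ C) : |(∑ x ∈ s, f x) / (s.card : ℝ)| ≤ C := by
  have hpos : (0 : ℝ) < s.card := by exact_mod_cast hs.card_pos
  rw [abs_div, abs_of_pos hpos, div_le_iff₀ hpos]
  refine (Finset.abs_sum_le_sum_abs _ _).trans
    ((Finset.sum_le_card_nsmul _ _ C fun x _ => hf x).trans_eq ?_)
  rw [nsmul_eq_mul, mul_comm]

/-- Ultralimits of finite averages are means. -/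
lemma exists_isMean_tendsto {α β : Type*} (Φ : ℕ → Finset β) (hΦ : ∀ N, (Φ N).Nonempty)
    (e : ℕ → β → α) (U : Ultrafilter ℕ) :
    ∃ m : (α → ℝ) →ₗ[ℝ] ℝ, IsMean m ∧ ∀ f, Bdd f →
      Tendsto (fun N => (∑ x ∈ Φ N, f (e N x)) / ((Φ N).card : ℝ)) U (𝓝 (m f)) := by
  have hlim : ∀ f : bddSubmodule α, ∃ y : ℝ,
      Tendsto (fun N => (∑ x ∈ Φ N, f.1 (e N x)) / ((Φ N).card : ℝ)) U (𝓝 y) := by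
    rintro ⟨f, C, hC⟩
    obtain ⟨y, -, hy⟩ := (isCompact_Icc (a := -C) (b := C)).ultrafilter_le_nhds
      (U.map fun N => (∑ x ∈ Φ N, f (e N x)) / ((Φ N).card : ℝ)) (by
        rw [le_principal_iff]
        exact Ultrafilter.mem_map.2 <| Filter.univ_mem' fun N =>
          abs_le.1 (abs_average_le (hΦ N) fun x => hC _))
    exact ⟨y, hy⟩
  choose L hL using hlim
  let L' : bddSubmodule α →ₗ[ℝ] ℝ :=
    { toFun := L
      map_add' := fun f g => by
        refine tendsto_nhds_unique (hL (f + g)) (((hL f).add (hL g)).congr fun N => ?_)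
        rw [← add_div, ← Finset.sum_add_distrib]
        rfl
      map_smul' := fun c f => by
        refine tendsto_nhds_unique (hL (c • f)) (((hL f).const_mul c).congr fun N => ?_)
        rw [← mul_div_assoc, Finset.mul_sum]
        rfl }
  obtain ⟨m, hm⟩ := L'.exists_extend
  have hmL : ∀ f, Bdd f →
      Tendsto (fun N => (∑ x ∈ Φ N, f (e N x)) / ((Φ N).card : ℝ)) U (𝓝 (m f)) := by
    intro f hf
    have : m f = L ⟨f, hf⟩ := LinearMap.congr_fun hm ⟨f, hf⟩
    rw [this]
    exact hL ⟨f, hf⟩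
  refine ⟨m, ⟨?_, fun f hf h => ?_⟩, hmL⟩
  · refine tendsto_nhds_unique (hmL _ (Bdd.const 1)) (tendsto_const_nhds.congr fun N => ?_)
    have : ((Φ N).card : ℝ) ≠ 0 := by exact_mod_cast (hΦ N).card_pos.ne'
    simp [this]
  · exact ge_of_tendsto' (hmL f hf) fun N =>
      div_nonneg (Finset.sum_nonneg fun x _ => h _) (Nat.cast_nonneg _)

/-- Averages along a right Følner sequence are asymptotically right invariant, uniformly over
uniformly bounded functions. -/
lemma IsRightFolner.tendsto_sub {H : Type*} [Group H] [DecidableEq H] {Φ : ℕ → Finset H}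
    (hΦ : IsRightFolner Φ) {ψ : ℕ → H → ℝ} {C : ℝ} (hψ : ∀ N x, |ψ N x| ≤ C) (k : H) :
    Tendsto (fun N => (∑ x ∈ Φ N, ψ N (x * k)) / ((Φ N).card : ℝ) -
      (∑ x ∈ Φ N, ψ N x) / ((Φ N).card : ℝ)) atTop (𝓝 0) := by
  have hlim : Tendsto (fun N => 2 * C * (1 -
      (((Φ N) ∩ (Φ N).image (fun x => x * k)).card : ℝ) / ((Φ N).card : ℝ))) atTop (𝓝 0) := by
    simpa using ((hΦ.2 k).const_sub 1).const_mul (2 * C)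
  refine squeeze_zero_norm (fun N => ?_) hlim
  set A := Φ N
  set B := A.image (fun x => x * k) with hB
  have hpos : (0 : ℝ) < A.card := by exact_mod_cast (hΦ.1 N).card_pos
  have hcard : B.card = A.card := Finset.card_image_of_injective _ (mul_left_injective k)
  have hsum : ∑ x ∈ A, ψ N (x * k) = ∑ x ∈ B, ψ N x := by
    rw [hB, Finset.sum_image fun x _ y _ h => mul_left_injective k h]
  have hdiff : ∑ x ∈ B, ψ N x - ∑ x ∈ A, ψ N x = ∑ x ∈ B \ A, ψ N x - ∑ x ∈ A \ B, ψ N x :=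
    Finset.sum_sdiff_sub_sum_sdiff.symm
  have hbound : ∀ s : Finset H, |∑ x ∈ s, ψ N x| ≤ s.card * C := fun s => by
    refine (Finset.abs_sum_le_sum_abs _ _).trans
      ((Finset.sum_le_card_nsmul _ _ C fun x _ => hψ N x).trans_eq (nsmul_eq_mul _ _))
  have h1 : ((A \ B).card : ℝ) = A.card - (A ∩ B).card := by
    rw [eq_sub_iff_add_eq]
    exact_mod_cast Finset.card_sdiff_add_card_inter A B
  have h2 : ((B \ A).card : ℝ) = A.card - (A ∩ B).card := by
    rw [eq_sub_iff_add_eq, ← hcard, Finset.inter_comm]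
    exact_mod_cast Finset.card_sdiff_add_card_inter B A
  rw [← sub_div, hsum, hdiff, Real.norm_eq_abs, abs_div, abs_of_pos hpos, div_le_iff₀ hpos]
  calc |∑ x ∈ B \ A, ψ N x - ∑ x ∈ A \ B, ψ N x|
      ≤ (B \ A).card * C + (A \ B).card * C :=
        (abs_sub _ _).trans (add_le_add (hbound _) (hbound _))
    _ = 2 * C * (1 - ((A ∩ B).card : ℝ) / A.card) * A.card := by
        rw [h1, h2]
        field_simp
        ring

/-- A right Følner sequence yields left-invariant means as ultralimits of averages over translates
of the inverted Følner sets under a homomorphism. -/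
lemma IsRightFolner.exists_leftInv {H K : Type*} [Group H] [DecidableEq H] [Group K]
    {Φ : ℕ → Finset H} (hΦ : IsRightFolner Φ) {π : H →* K} (hπ : Function.Surjective π)
    (y : ℕ → K) :
    ∃ θ : (K → ℝ) →ₗ[ℝ] ℝ, IsMean θ ∧ IsLeftInv θ ∧
      ∀ (F : K → ℝ) (c : ℝ), Bdd F → (∀ N, ∀ x ∈ Φ N, F ((π x)⁻¹ * y N) ≤ c) → θ F ≤ c := by
  obtain ⟨θ, hθ, hlim⟩ := exists_isMean_tendsto Φ hΦ.1 (fun N x => (π x)⁻¹ * y N)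
    (hyperfilter ℕ)
  refine ⟨θ, hθ, fun k F hF => ?_, fun F c hF hc => ?_⟩
  · obtain ⟨h, rfl⟩ := hπ k
    obtain ⟨C, hC⟩ := hF
    have h0 := (hΦ.tendsto_sub (ψ := fun N x => F ((π x)⁻¹ * y N)) (fun N x => hC _) h⁻¹).mono_left
      Nat.hyperfilter_le_atTop
    have h1 := (hlim _ (Bdd.comp ⟨C, hC⟩ fun x => π h * x)).sub (hlim F ⟨C, hC⟩)
    refine sub_eq_zero.1 (tendsto_nhds_unique h1 (h0.congr fun N => ?_))
    simp [mul_assoc]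
  · refine le_of_tendsto' (hlim F hF) fun N => ?_
    rw [div_le_iff₀ (by exact_mod_cast (hΦ.1 N).card_pos)]
    refine (Finset.sum_le_card_nsmul _ _ c fun x hx => hc N x hx).trans_eq ?_
    rw [nsmul_eq_mul, mul_comm]

open scoped Classical in
lemma density_mem_Icc {H : Type*} (s : Finset H) (A : Set H) :
    ((s.filter (fun x => x ∈ A)).card : ℝ) / (s.card : ℝ) ∈ Set.Icc (0 : ℝ) 1 :=
  ⟨by positivity, div_le_one_of_le₀ (by exact_mod_cast Finset.card_filter_le _ _)
    (Nat.cast_nonneg _)⟩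

/-- There is a right-invariant mean that computes the upper density of a given set and is bounded
by the upper density on all sets. -/
lemma IsRightFolner.exists_mean_eq_upperDensity {H : Type*} [Group H] [DecidableEq H]
    {Φ : ℕ → Finset H} (hΦ : IsRightFolner Φ) (E : Set H) :
    ∃ m : (H → ℝ) →ₗ[ℝ] ℝ, IsMean m ∧ IsRightInv m ∧
      m (E.indicator fun _ => 1) = upperDensity Φ E ∧
      ∀ A : Set H, m (A.indicator fun _ => 1) ≤ upperDensity Φ A := by
  classical
  have hind : ∀ (A : Set H) N, (∑ x ∈ Φ N, A.indicator (fun _ => (1 : ℝ)) x) / ((Φ N).card : ℝ) =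
      (((Φ N).filter (fun x => x ∈ A)).card : ℝ) / ((Φ N).card : ℝ) := by
    intro A N
    simp [Set.indicator_apply]
  have hbdd : ∀ A : Set H, IsBoundedUnder (· ≤ ·) atTop
      (fun N => (((Φ N).filter (fun x => x ∈ A)).card : ℝ) / ((Φ N).card : ℝ)) := fun A =>
    isBoundedUnder_of ⟨1, fun N => (density_mem_Icc _ A).2⟩
  have hcob : ∀ A : Set H, IsCoboundedUnder (· ≤ ·) atTop
      (fun N => (((Φ N).filter (fun x => x ∈ A)).card : ℝ) / ((Φ N).card : ℝ)) := fun A =>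
    isCoboundedUnder_le_of_le atTop fun N => (density_mem_Icc _ A).1
  have hcl : MapClusterPt (upperDensity Φ E) atTop
      (fun N => (((Φ N).filter (fun x => x ∈ E)).card : ℝ) / ((Φ N).card : ℝ)) := by
    simpa only [upperDensity] using MapClusterPt.limsup (hcob E) (hbdd E)
  obtain ⟨U, hU, hUE⟩ := mapClusterPt_iff_ultrafilter.1 hcl
  obtain ⟨m, hm, hlim⟩ := exists_isMean_tendsto Φ hΦ.1 (fun _ x => x) U
  have hA : ∀ A : Set H, Bdd (A.indicator fun _ => (1 : ℝ)) := fun A =>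
    ⟨1, fun x => by by_cases hx : x ∈ A <;> simp [hx]⟩
  have hlimA : ∀ A : Set H, Tendsto
      (fun N => (((Φ N).filter (fun x => x ∈ A)).card : ℝ) / ((Φ N).card : ℝ)) U
      (𝓝 (m (A.indicator fun _ => 1))) := fun A => (hlim _ (hA A)).congr (hind A)
  refine ⟨m, hm, fun h F hF => ?_, tendsto_nhds_unique (hlimA E) hUE, fun A => ?_⟩
  · obtain ⟨C, hC⟩ := hF
    have h0 := (hΦ.tendsto_sub (ψ := fun _ => F) (fun _ x => hC x) h).mono_left hU
    have h1 := (hlim _ (Bdd.comp ⟨C, hC⟩ fun x => x * h)).sub (hlim F ⟨C, hC⟩)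
    exact sub_eq_zero.1 (tendsto_nhds_unique h1 h0)
  · refine le_of_forall_gt_imp_ge_of_dense fun r hr => ?_
    refine le_of_tendsto (hlimA A) (hU ?_)
    filter_upwards [eventually_lt_of_limsup_lt hr (hbdd A)] with N hN using hN.le

lemma LeftSyndetic.mono {H : Type*} [Group H] {S T : Set H} (hS : LeftSyndetic S) (h : S ⊆ T) :
    LeftSyndetic T := by
  obtain ⟨F, hF⟩ := hS
  exact ⟨F, fun x => (hF x).imp fun g hg => ⟨hg.1, h hg.2⟩⟩

lemma RightSyndetic.mono {H : Type*} [Group H] {S T : Set H} (hS : RightSyndetic S) (h : S ⊆ T) :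
    RightSyndetic T := by
  obtain ⟨F, hF⟩ := hS
  exact ⟨F, fun x => (hF x).imp fun g hg => ⟨hg.1, h hg.2⟩⟩

lemma LeftSyndetic.rightSyndetic_of_inv {H : Type*} [Group H] {S : Set H} (hS : LeftSyndetic S)
    (h : ∀ x ∈ S, x⁻¹ ∈ S) : RightSyndetic S := by
  classical
  obtain ⟨F, hF⟩ := hS
  refine ⟨F.image (·⁻¹), fun x => ?_⟩
  obtain ⟨g, hg, hgx⟩ := hF x⁻¹
  exact ⟨g⁻¹, Finset.mem_image_of_mem _ hg, by simpa using h _ hgx⟩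

/-- The square correlations of a bounded function exceed any value below the fourth power of its
mean on a left syndetic set. -/
lemma leftSyndetic_squareCorr {G : Type*} [Group G] [DecidableEq G] {Φ : ℕ → Finset (G × G)}
    (hΦ : IsRightFolner Φ) {m : (G × G → ℝ) →ₗ[ℝ] ℝ} (hm : IsMean m) (hmi : IsRightInv m)
    {f : G × G → ℝ} (hf : ∀ x, |f x| ≤ 1) {c : ℝ} (hc : 0 < c) :
    LeftSyndetic {p | squareCorr m f p > m f ^ 4 - c} := by
  by_contra hS
  simp only [LeftSyndetic, not_exists, not_forall, not_and] at hS
  choose y hy using fun N => hS (Φ N)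
  obtain ⟨θ, hθ, iθ, hθc⟩ := hΦ.exists_leftInv (π := MonoidHom.id _) Function.surjective_id y
  obtain ⟨η₁, h₁, i₁, -⟩ := hΦ.exists_leftInv (π := MonoidHom.fst G G) Prod.fst_surjective 1
  obtain ⟨η₂, h₂, i₂, -⟩ := hΦ.exists_leftInv (π := MonoidHom.snd G G) Prod.snd_surjective 1
  have hlow := pow_four_le_iterMean_squareCorr hm hmi hf h₁ h₂ i₁ i₂
  rw [average_squareCorr_eq hm hmi hf (h₁.iterMean h₂) hθ (i₁.iterMean h₂ i₂) iθ] at hlow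
  have hup : θ (squareCorr m f) ≤ m f ^ 4 - c :=
    hθc _ _ ⟨1, fun p => hm.abs_le fun x => abs_mul_le_one (hf _) (abs_squareFactor_le hf _ _)⟩
      fun N x hx => not_lt.1 (hy N x hx)
  linarith

lemma mem_rightShift_inv {G : Type*} [Group G] {E : Set (G × G)} {a b : G} {x : G × G} :
    x ∈ rightShift E a⁻¹ b⁻¹ ↔ (x.1 * a, x.2 * b) ∈ E := by
  constructor
  · rintro ⟨q, hq, rfl⟩
    simpa using hq
  · intro h
    exact ⟨_, h, by simp⟩

lemma squareCorr_indicator {G : Type*} [Group G] (m : (G × G → ℝ) →ₗ[ℝ] ℝ) (E : Set (G × G))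
    (p : G × G) : squareCorr m (E.indicator fun _ => 1) p =
      m ((E ∩ rightShift E p.1⁻¹ 1 ∩ rightShift E 1 p.2⁻¹ ∩
        rightShift E p.1⁻¹ p.2⁻¹).indicator fun _ => 1) := by
  classical
  have h₁ (x : G × G) : x ∈ rightShift E p.1⁻¹ 1 ↔ (x.1 * p.1, x.2) ∈ E := by
    simpa using mem_rightShift_inv (E := E) (a := p.1) (b := 1) (x := x)
  have h₂ (x : G × G) : x ∈ rightShift E 1 p.2⁻¹ ↔ (x.1, x.2 * p.2) ∈ E := by
    simpa using mem_rightShift_inv (E := E) (a := 1) (b := p.2) (x := x)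
  rw [squareCorr]
  congr 1
  ext x
  simp only [squareFactor, Set.indicator_apply, Set.mem_inter_iff,
    h₁, h₂, mem_rightShift_inv, Prod.mul_def]
  split_ifs <;> simp_all

/-- If `E ⊆ G × G` has upper density `δ > 0` with respect to a right Følner
sequence `Φ` in `G × G`, then for all `c > 0` the set of `(g,h)` with
`d_Φ(E ∩ E(g⁻¹,e) ∩ E(e,h⁻¹) ∩ E(g⁻¹,h⁻¹)) > δ⁴ - c` is left and right syndetic in `G × G`. -/
theorem two_dimensional_khintchine_syndetic
    {G : Type*} [Group G] [Countable G] [DecidableEq G]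
    (E : Set (G × G)) (Φ : ℕ → Finset (G × G)) (hΦ : IsRightFolner Φ)
    (δ : ℝ) (hδ : upperDensity Φ E = δ) (hδpos : 0 < δ) :
    ∀ c > (0 : ℝ),
      LeftSyndetic {p : G × G |
        upperDensity Φ
          (E ∩ rightShift E p.1⁻¹ 1 ∩ rightShift E 1 p.2⁻¹ ∩ rightShift E p.1⁻¹ p.2⁻¹)
          > δ ^ 4 - c} ∧
      RightSyndetic {p : G × G |
        upperDensity Φ
          (E ∩ rightShift E p.1⁻¹ 1 ∩ rightShift E 1 p.2⁻¹ ∩ rightShift E p.1⁻¹ p.2⁻¹)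
          > δ ^ 4 - c} := by
  intro c hc
  obtain ⟨m, hm, hmi, hmE, hmA⟩ := hΦ.exists_mean_eq_upperDensity E
  have hf : ∀ x, |E.indicator (fun _ => (1 : ℝ)) x| ≤ 1 := fun x => by
    by_cases hx : x ∈ E <;> simp [hx]
  have hS := leftSyndetic_squareCorr hΦ hm hmi hf hc
  rw [hmE, hδ] at hS
  have hsub : {p | squareCorr m (E.indicator fun _ => 1) p > δ ^ 4 - c} ⊆ {p : G × G |
      upperDensity Φ
        (E ∩ rightShift E p.1⁻¹ 1 ∩ rightShift E 1 p.2⁻¹ ∩ rightShift E p.1⁻¹ p.2⁻¹)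
        > δ ^ 4 - c} := fun p hp =>
    (lt_of_lt_of_eq hp (squareCorr_indicator m E p)).trans_le (hmA _)
  refine ⟨hS.mono hsub, (hS.rightSyndetic_of_inv fun p hp => ?_).mono hsub⟩
  exact lt_of_lt_of_eq hp (squareCorr_inv hf hmi p).symm
end
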